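/- arXiv:2503.03217 — 2 statements merged into one kernel-verified Lean document; each statement's English description precedes it below -/
import Mathlib

section
/- Let g = θ ∘ λ : Sⁿ → ℝ ∪ {+∞} where θ : ℝⁿ → ℝ ∪ {+∞} is a symmetric polyhedral convex function and λ(X) is the vector of eigenvalues of X ∈ Sⁿ in nonincreasing order. Then g is convex, and for (X, Y) ∈ gph ∂g the critical cone satisfies C_g(X, Y) = N_{∂g(X)}(Y); moreover, the second subderivative d²g(X, Y) is a generalized quadratic form if and only if Y ∈ ri ∂g(X). -/
/- STATEMENT 8: g = θ∘λ with θ symmetric polyhedral convex is convex; for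
(X,Y) ∈ gph ∂g the critical cone equals the normal cone N_{∂g(X)}(Y); and the
second subderivative d²g(X,Y) is a generalized quadratic form iff Y ∈ ri ∂g(X). -/

open Classical Matrix Filter Topology

noncomputable section

abbrev Mat (n : ℕ) := Matrix (Fin n) (Fin n) ℝ

/-- Eigenvalues in nonincreasing order (junk value if not symmetric). -/
noncomputable def eigs {m : ℕ} (A : Mat m) : Fin m → ℝ :=
  if h : A.IsHermitian then (fun i => h.eigenvalues (Tuple.sort h.eigenvalues i.rev)) else 0

/-- Frobenius inner product. -/
def frob {m : ℕ} (A B : Mat m) : ℝ := (Aᵀ * B).trace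

/-- The spectral function θ∘λ, set to ⊤ off the symmetric matrices. -/
def specFn {n : ℕ} (θ : (Fin n → ℝ) → EReal) (A : Mat n) : EReal :=
  if A.IsHermitian then θ (eigs A) else ⊤

/-- Convexity on the space of symmetric matrices. -/
def ConvexMFn {n : ℕ} (g : Mat n → EReal) : Prop :=
  ∀ A B : Mat n, A.IsHermitian → B.IsHermitian → ∀ a b : ℝ, 0 ≤ a → 0 ≤ b → a + b = 1 →
    g (a • A + b • B) ≤ (a : EReal) * g A + (b : EReal) * g B

/-- Subdifferential (convex analysis, Frobenius inner product) on Sⁿ. -/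
def MSubdiff {n : ℕ} (g : Mat n → EReal) (X : Mat n) : Set (Mat n) :=
  {Y | Y.IsHermitian ∧ ∀ Z : Mat n, Z.IsHermitian →
    g X + ((frob Y (Z - X) : ℝ) : EReal) ≤ g Z}

/-- Subderivative dg(X)(H). -/
def MSubderiv {n : ℕ} (g : Mat n → EReal) (X H : Mat n) : EReal :=
  Filter.liminf
    (fun q : ℝ × Mat n => (((1 / q.1 : ℝ)) : EReal) * (g (X + q.1 • q.2) - g X))
    ((𝓝[>] (0 : ℝ)) ×ˢ 𝓝 H)

/-- Second subderivative d²g(X,Y)(H). -/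
def MSub2 {n : ℕ} (g : Mat n → EReal) (X Y H : Mat n) : EReal :=
  Filter.liminf
    (fun q : ℝ × Mat n => (((2 / q.1 ^ 2 : ℝ)) : EReal) *
      (g (X + q.1 • q.2) - g X - ((q.1 * frob Y q.2 : ℝ) : EReal)))
    ((𝓝[>] (0 : ℝ)) ×ˢ 𝓝 H)

/-- Critical cone C_g(X,Y) = {H ∈ Sⁿ : ⟨Y,H⟩ = dg(X)(H)}. -/
def MCrit {n : ℕ} (g : Mat n → EReal) (X Y : Mat n) : Set (Mat n) :=
  {H | H.IsHermitian ∧ ((frob Y H : ℝ) : EReal) = MSubderiv g X H}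

/-- Generalized quadratic form on Sⁿ: the domain is a linear subspace of the
symmetric matrices on which the function is a symmetric quadratic form. -/
def IsMGQF {n : ℕ} (q : Mat n → EReal) : Prop :=
  ∃ (S : Submodule ℝ (Mat n)) (L : S →ₗ[ℝ] Mat n),
    (∀ A : S, (A : Mat n).IsHermitian) ∧
    (∀ A B : S, frob ((L A : Mat n)) (B : Mat n) = frob ((A : Mat n)) (L B : Mat n)) ∧
    ∀ A : Mat n, q A = if h : A ∈ S then ((frob (L ⟨A, h⟩) A : ℝ) : EReal) else ⊤

/-- Epigraph, used to express polyhedrality of θ. -/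
def EpigraphP {α : Type*} (f : α → EReal) : Set (α × ℝ) := {p | f p.1 ≤ (p.2 : EReal)}

/-- θ : ℝⁿ → ℝ∪{+∞} is polyhedral: epigraph a finite intersection of halfspaces. -/
def PolyPi {n : ℕ} (θ : (Fin n → ℝ) → EReal) : Prop :=
  ∃ (m : ℕ) (A : Fin m → (Fin n → ℝ)) (a b : Fin m → ℝ),
    EpigraphP θ = {p | ∀ i, (A i) ⬝ᵥ p.1 + a i * p.2 ≤ b i}

/-- A proper, permutation-invariant, polyhedral function. -/
structure IsSymmPolyhedral {n : ℕ} (θ : (Fin n → ℝ) → EReal) : Prop where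
  symm : ∀ (σ : Equiv.Perm (Fin n)) (x : Fin n → ℝ), θ (x ∘ σ) = θ x
  poly : PolyPi θ
  ne_bot : ∀ x, θ x ≠ ⊥
  exists_ne_top : ∃ x, θ x ≠ ⊤

theorem EReal.exists_coe_eq {a : EReal} (h₁ : a ≠ ⊥) (h₂ : a ≠ ⊤) : ∃ r : ℝ, a = r :=
  ⟨a.toReal, (EReal.coe_toReal h₂ h₁).symm⟩

theorem EReal.le_of_forall_real_ge {a b : EReal} (hb : b ≠ ⊥)
    (h : ∀ s : ℝ, b ≤ s → a ≤ s) : a ≤ b := by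
  by_cases ht : b = ⊤
  · simp [ht]
  · obtain ⟨r, rfl⟩ := EReal.exists_coe_eq hb ht
    exact h r le_rfl

theorem PolyPi.convex_epigraph {n : ℕ} {θ : (Fin n → ℝ) → EReal} (h : PolyPi θ) :
    Convex ℝ (EpigraphP θ) := by
  obtain ⟨m, A, a, b, h⟩ := h
  rw [h]
  intro p hp q hq s t hs ht hst i
  have h₁ := mul_le_mul_of_nonneg_left (hp i) hs
  have h₂ := mul_le_mul_of_nonneg_left (hq i) ht
  simp only [Prod.fst_add, Prod.smul_fst, Prod.snd_add, Prod.smul_snd, dotProduct_add,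
    dotProduct_smul, smul_eq_mul]
  have : b i = s * b i + t * b i := by rw [← add_mul, hst, one_mul]
  linarith

/-- A finite polyhedral function whose subgradients all satisfy `⟨z, h⟩ ≤ c` grows at most
linearly with slope `c` along `h`. -/
theorem PolyPi.eventually_le_of_subgradient {n : ℕ} {θ : (Fin n → ℝ) → EReal} (hp : PolyPi θ)
    {x y h : Fin n → ℝ} {r c : ℝ} (hx : θ x = r)
    (hy : ∀ u (s : ℝ), θ u ≤ s → r + y ⬝ᵥ (u - x) ≤ s)
    (hc : ∀ z : Fin n → ℝ, (∀ u (s : ℝ), θ u ≤ s → r + z ⬝ᵥ (u - x) ≤ s) → z ⬝ᵥ h ≤ c) :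
    ∀ᶠ t : ℝ in 𝓝[>] 0, θ (x + t • h) ≤ ((r + t * c : ℝ) : EReal) := by
  obtain ⟨m, A, a, b, hE⟩ := hp
  have mem : ∀ u (s : ℝ), θ u ≤ s ↔ ∀ i, A i ⬝ᵥ u + a i * s ≤ b i := fun u s => by
    have : (u, s) ∈ EpigraphP θ ↔ (u, s) ∈
        {p : (Fin n → ℝ) × ℝ | ∀ i, (A i) ⬝ᵥ p.1 + a i * p.2 ≤ b i} := by
      rw [hE]
    simpa [EpigraphP] using this
  have hx0 : ∀ i, A i ⬝ᵥ x + a i * r ≤ b i := (mem x r).1 hx.le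
  have ha : ∀ i, a i ≤ 0 := by
    intro i
    by_contra! hi
    obtain ⟨k, hk⟩ := exists_nat_gt ((b i - (A i ⬝ᵥ x + a i * r)) / a i)
    rw [div_lt_iff₀ hi] at hk
    have h1 := (mem x (r + k)).1 (by
      rw [hx]; exact_mod_cast le_add_of_nonneg_right (Nat.cast_nonneg k)) i
    nlinarith
  simp_rw [mem]
  refine eventually_all.2 fun i => ?_
  have key : ∀ t : ℝ, A i ⬝ᵥ (x + t • h) + a i * (r + t * c) =
      (A i ⬝ᵥ x + a i * r) + t * (A i ⬝ᵥ h + a i * c) := fun t => by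
    simp only [dotProduct_add, dotProduct_smul, smul_eq_mul]; ring
  simp_rw [key]
  rcases (hx0 i).lt_or_eq with hlt | hact
  · have : Tendsto (fun t : ℝ => (A i ⬝ᵥ x + a i * r) + t * (A i ⬝ᵥ h + a i * c)) (𝓝 0)
        (𝓝 ((A i ⬝ᵥ x + a i * r) + 0 * (A i ⬝ᵥ h + a i * c))) :=
      Continuous.tendsto (by fun_prop) 0
    rw [zero_mul, add_zero] at this
    exact ((this.eventually (gt_mem_nhds hlt)).mono fun t ht => le_of_lt ht).filter_mono
      nhdsWithin_le_nhds
  · suffices hle : A i ⬝ᵥ h + a i * c ≤ 0 by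
      filter_upwards [self_mem_nhdsWithin] with t (ht : 0 < t)
      nlinarith
    by_contra! hpos
    rcases (ha i).lt_or_eq with hneg | hzero
    · have := hc ((-a i)⁻¹ • A i) (fun u s hus => by
        have h1 := (mem u s).1 hus i
        have h2 : 0 < (-a i)⁻¹ := by rw [inv_pos]; linarith
        have h3 : (-a i)⁻¹ * (-a i) = 1 := inv_mul_cancel₀ (by linarith)
        rw [smul_dotProduct, dotProduct_sub, smul_eq_mul]
        have h4 : A i ⬝ᵥ u - A i ⬝ᵥ x ≤ -a i * (s - r) := by linarith
        have h5 := mul_le_mul_of_nonneg_left h4 h2.le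
        rw [← mul_assoc, h3] at h5
        linarith)
      rw [smul_dotProduct, smul_eq_mul, inv_mul_le_iff₀ (by linarith)] at this
      linarith
    · rw [hzero, zero_mul, add_zero] at hpos
      obtain ⟨k, hk⟩ := exists_nat_gt ((c - y ⬝ᵥ h) / (A i ⬝ᵥ h))
      rw [div_lt_iff₀ hpos] at hk
      have := hc (y + (k : ℝ) • A i) (fun u s hus => by
        have h1 := (mem u s).1 hus i
        have h2 := hy u s hus
        have h3 : A i ⬝ᵥ (u - x) ≤ 0 := by
          rw [dotProduct_sub]; rw [hzero] at h1 hact; linarith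
        rw [add_dotProduct, smul_dotProduct, smul_eq_mul]
        have h4 : (0 : ℝ) ≤ k := Nat.cast_nonneg k
        nlinarith)
      rw [add_dotProduct, smul_dotProduct, smul_eq_mul] at this
      linarith

theorem IsSymmPolyhedral.orthostochastic_le {n : ℕ} {θ : (Fin n → ℝ) → EReal}
    (hθ : IsSymmPolyhedral θ) {R : Mat n} (hR : Rᵀ * R = 1) (x : Fin n → ℝ) :
    θ (fun i => ∑ j, R i j ^ 2 * x j) ≤ θ x := by
  refine EReal.le_of_forall_real_ge (hθ.ne_bot x) fun s hs => ?_
  set D : Mat n := fun i j => R i j ^ 2 with hD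
  have hR' : R * Rᵀ = 1 := mul_eq_one_comm.mp hR
  have hmem : D ∈ (doublyStochastic ℝ (Fin n) : Set (Mat n)) := by
    rw [SetLike.mem_coe, mem_doublyStochastic_iff_sum]
    refine ⟨fun i j => sq_nonneg _, fun i => ?_, fun j => ?_⟩
    · have := congrFun (congrFun hR' i) i
      simpa [hD, Matrix.mul_apply, sq] using this
    · have := congrFun (congrFun hR j) j
      simpa [hD, Matrix.mul_apply, sq] using this
  rw [doublyStochastic_eq_convexHull_permMatrix] at hmem
  let f : Mat n →ₗ[ℝ] (Fin n → ℝ) :=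
    { toFun := fun M => M *ᵥ x
      map_add' := fun M N => Matrix.add_mulVec M N x
      map_smul' := fun a M => Matrix.smul_mulVec a M x }
  have hconv : Convex ℝ {M : Mat n | θ (f M) ≤ s} := by
    intro M hM N hN a b ha hb hab
    have := hθ.poly.convex_epigraph (x := (f M, s)) hM (y := (f N, s)) hN ha hb hab
    simp only [EpigraphP, Set.mem_ofPred_eq, Prod.fst_add, Prod.smul_fst, Prod.snd_add,
      Prod.smul_snd, smul_eq_mul, ← add_mul, hab, one_mul] at this
    simpa using this
  have := convexHull_min (s := {σ.permMatrix ℝ | σ : Equiv.Perm (Fin n)})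
    (t := {M : Mat n | θ (f M) ≤ s}) (by
    rintro _ ⟨σ, rfl⟩
    have : f (σ.permMatrix ℝ) = x ∘ σ := by
      ext i
      simp [f, Matrix.mulVec, dotProduct, Equiv.Perm.permMatrix, PEquiv.toMatrix_apply]
    change θ (f (σ.permMatrix ℝ)) ≤ s
    rw [this, hθ.symm]
    exact hs) hconv hmem
  exact this

theorem frob_eq_trace_mul {n : ℕ} {A : Mat n} (hA : Aᵀ = A) (B : Mat n) :
    frob A B = (A * B).trace := by rw [frob, hA]

theorem frob_comm {n : ℕ} (A B : Mat n) : frob A B = frob B A := by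
  rw [frob, frob, ← Matrix.trace_transpose (Aᵀ * B), Matrix.transpose_mul,
    Matrix.transpose_transpose]

theorem frob_add_right {n : ℕ} (A B C : Mat n) : frob A (B + C) = frob A B + frob A C := by
  simp [frob, mul_add]

theorem frob_sub_right {n : ℕ} (A B C : Mat n) : frob A (B - C) = frob A B - frob A C := by
  simp [frob, mul_sub]

theorem frob_smul_right {n : ℕ} (a : ℝ) (A B : Mat n) : frob A (a • B) = a * frob A B := by
  simp [frob]

theorem frob_add_left {n : ℕ} (A B C : Mat n) : frob (A + B) C = frob A C + frob B C := by
  simp [frob, add_mul]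

theorem frob_sub_left {n : ℕ} (A B C : Mat n) : frob (A - B) C = frob A C - frob B C := by
  simp [frob, sub_mul]

theorem frob_smul_left {n : ℕ} (a : ℝ) (A B : Mat n) : frob (a • A) B = a * frob A B := by
  simp [frob]

theorem frob_conj {n : ℕ} {V : Mat n} (A B : Mat n) :
    frob (V * A * Vᵀ) B = frob A (Vᵀ * B * V) := by
  simp only [frob, Matrix.transpose_mul,
    Matrix.transpose_transpose]
  rw [mul_assoc, Matrix.trace_mul_comm]
  simp only [mul_assoc]

theorem frob_diagonal_left {n : ℕ} (d : Fin n → ℝ) (B : Mat n) :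
    frob (diagonal d) B = d ⬝ᵥ diag B := by
  simp [frob, Matrix.trace, dotProduct, Matrix.diagonal_mul]

theorem continuous_frob {n : ℕ} : Continuous fun p : Mat n × Mat n => frob p.1 p.2 := by
  unfold frob; fun_prop

theorem isHermitian_iff_transpose {n : ℕ} {A : Mat n} : A.IsHermitian ↔ Aᵀ = A := by
  rw [Matrix.IsHermitian, Matrix.conjTranspose_eq_transpose_of_trivial]

theorem Matrix.IsHermitian.transpose_eq' {n : ℕ} {A : Mat n} (h : A.IsHermitian) : Aᵀ = A :=
  isHermitian_iff_transpose.1 h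

theorem isHermitian_conj {n : ℕ} {A : Mat n} (hA : A.IsHermitian) (V : Mat n) :
    (V * A * Vᵀ).IsHermitian := by
  rw [isHermitian_iff_transpose]
  simp [Matrix.transpose_mul, hA.transpose_eq', mul_assoc]

theorem exists_orthogonal_diagonalization {n : ℕ} {A : Mat n} (hA : A.IsHermitian) :
    ∃ U : Mat n, Uᵀ * U = 1 ∧ A = U * diagonal hA.eigenvalues * Uᵀ := by
  refine ⟨hA.eigenvectorUnitary, ?_, ?_⟩
  · have := Unitary.coe_star_mul_self hA.eigenvectorUnitary
    rwa [Matrix.star_eq_conjTranspose, Matrix.conjTranspose_eq_transpose_of_trivial] at this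
  · conv_lhs => rw [hA.spectral_theorem]
    rw [Unitary.conjStarAlgAut_apply, Matrix.star_eq_conjTranspose,
      Matrix.conjTranspose_eq_transpose_of_trivial]
    rfl

theorem isHermitian_orthogonal_diagonal {n : ℕ} (V : Mat n) (x : Fin n → ℝ) :
    (V * diagonal x * Vᵀ).IsHermitian :=
  isHermitian_conj (isHermitian_iff_transpose.2 (by simp)) V

theorem diag_conj_diagonal {n : ℕ} (R : Mat n) (x : Fin n → ℝ) :
    diag (R * diagonal x * Rᵀ) = fun i => ∑ j, R i j ^ 2 * x j := by
  ext i
  rw [diag_apply, Matrix.mul_apply]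
  exact Finset.sum_congr rfl fun j _ => by
    rw [Matrix.mul_diagonal, Matrix.transpose_apply]; ring

section Spectral

variable {n : ℕ} {θ : (Fin n → ℝ) → EReal}

theorem specFn_eq_eigenvalues (hθ : IsSymmPolyhedral θ) {A : Mat n} (hA : A.IsHermitian) :
    specFn θ A = θ hA.eigenvalues := by
  rw [specFn, if_pos hA, eigs, dif_pos hA]
  exact hθ.symm (Fin.revPerm.trans (Tuple.sort hA.eigenvalues)) hA.eigenvalues

theorem IsSymmPolyhedral.le_of_orthogonal_diagonal_eq (hθ : IsSymmPolyhedral θ) {U V : Mat n}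
    (hU : Uᵀ * U = 1) (hV : Vᵀ * V = 1) {x y : Fin n → ℝ}
    (h : U * diagonal x * Uᵀ = V * diagonal y * Vᵀ) : θ x ≤ θ y := by
  have h1 : diagonal x = (Uᵀ * V) * diagonal y * (Uᵀ * V)ᵀ := by
    calc diagonal x = (Uᵀ * U) * diagonal x * (Uᵀ * U) := by rw [hU]; simp
      _ = Uᵀ * (U * diagonal x * Uᵀ) * U := by simp only [mul_assoc]
      _ = _ := by rw [h]; simp [mul_assoc]
  have h2 : (Uᵀ * V)ᵀ * (Uᵀ * V) = 1 := by
    have : U * Uᵀ = 1 := mul_eq_one_comm.mp hU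
    calc (Uᵀ * V)ᵀ * (Uᵀ * V) = Vᵀ * (U * Uᵀ) * V := by simp [mul_assoc]
      _ = 1 := by rw [this, mul_one, hV]
  have h3 : x = fun i => ∑ j, (Uᵀ * V) i j ^ 2 * y j := by
    rw [← diag_conj_diagonal, ← h1, diag_diagonal]
  rw [h3]
  exact hθ.orthostochastic_le h2 y

theorem specFn_orthogonal_diagonal (hθ : IsSymmPolyhedral θ) {V : Mat n} (hV : Vᵀ * V = 1)
    (x : Fin n → ℝ) : specFn θ (V * diagonal x * Vᵀ) = θ x := by
  have hA := isHermitian_orthogonal_diagonal V x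
  obtain ⟨U, hU, h⟩ := exists_orthogonal_diagonalization hA
  rw [specFn_eq_eigenvalues hθ hA]
  exact le_antisymm (hθ.le_of_orthogonal_diagonal_eq hU hV h.symm)
    (hθ.le_of_orthogonal_diagonal_eq hV hU h)

theorem theta_diag_conj_le_specFn (hθ : IsSymmPolyhedral θ) {V : Mat n} (hV : Vᵀ * V = 1)
    {A : Mat n} (hA : A.IsHermitian) : θ (diag (Vᵀ * A * V)) ≤ specFn θ A := by
  obtain ⟨U, hU, h⟩ := exists_orthogonal_diagonalization hA
  rw [specFn_eq_eigenvalues hθ hA]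
  have h1 : Vᵀ * A * V = (Vᵀ * U) * diagonal hA.eigenvalues * (Vᵀ * U)ᵀ := by
    conv_lhs => rw [h]
    simp [mul_assoc]
  have h2 : (Vᵀ * U)ᵀ * (Vᵀ * U) = 1 := by
    have : V * Vᵀ = 1 := mul_eq_one_comm.mp hV
    calc (Vᵀ * U)ᵀ * (Vᵀ * U) = Uᵀ * (V * Vᵀ) * U := by simp [mul_assoc]
      _ = 1 := by rw [this, mul_one, hU]
  rw [h1, diag_conj_diagonal]
  exact hθ.orthostochastic_le h2 _

theorem specFn_conj (hθ : IsSymmPolyhedral θ) {V : Mat n} (hV : Vᵀ * V = 1)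
    {A : Mat n} (hA : A.IsHermitian) : specFn θ (V * A * Vᵀ) = specFn θ A := by
  obtain ⟨U, hU, h⟩ := exists_orthogonal_diagonalization hA
  have h1 : V * A * Vᵀ = (V * U) * diagonal hA.eigenvalues * (V * U)ᵀ := by
    conv_lhs => rw [h]
    simp [mul_assoc]
  have h2 : (V * U)ᵀ * (V * U) = 1 := by
    calc (V * U)ᵀ * (V * U) = Uᵀ * (Vᵀ * V) * U := by simp [mul_assoc]
      _ = 1 := by rw [hV, mul_one, hU]
  rw [h1, specFn_orthogonal_diagonal hθ h2, specFn_eq_eigenvalues hθ hA]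

theorem specFn_ne_bot (hθ : IsSymmPolyhedral θ) (A : Mat n) : specFn θ A ≠ ⊥ := by
  by_cases hA : A.IsHermitian
  · rw [specFn_eq_eigenvalues hθ hA]
    exact hθ.ne_bot _
  · rw [specFn, if_neg hA]
    exact top_ne_bot

theorem convexMFn_specFn (hθ : IsSymmPolyhedral θ) : ConvexMFn (specFn θ) := by
  intro A B hA hB a b ha hb hab
  rcases ha.eq_or_lt with rfl | ha'
  · obtain rfl : b = 1 := by linarith
    simp
  rcases hb.eq_or_lt with rfl | hb'
  · obtain rfl : a = 1 := by linarith
    simp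
  by_cases hAt : specFn θ A = ⊤
  · rw [hAt, EReal.coe_mul_top_of_pos ha', EReal.top_add_of_ne_bot]
    · exact le_top
    · exact (EReal.mul_ne_bot _ _).2 (by simp [specFn_ne_bot hθ, hb'.le])
  by_cases hBt : specFn θ B = ⊤
  · rw [hBt, EReal.coe_mul_top_of_pos hb', EReal.add_top_of_ne_bot]
    · exact le_top
    · exact (EReal.mul_ne_bot _ _).2 (by simp [specFn_ne_bot hθ, ha'.le])
  obtain ⟨p, hp⟩ := EReal.exists_coe_eq (specFn_ne_bot hθ A) hAt
  obtain ⟨q, hq⟩ := EReal.exists_coe_eq (specFn_ne_bot hθ B) hBt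
  have hC : (a • A + b • B).IsHermitian := by
    rw [isHermitian_iff_transpose]
    simp [hA.transpose_eq', hB.transpose_eq']
  obtain ⟨U, hU, h⟩ := exists_orthogonal_diagonalization hC
  have h1 : hC.eigenvalues = a • diag (Uᵀ * A * U) + b • diag (Uᵀ * B * U) := by
    have : diagonal hC.eigenvalues = Uᵀ * (a • A + b • B) * U := by
      calc diagonal hC.eigenvalues = (Uᵀ * U) * diagonal hC.eigenvalues * (Uᵀ * U) := by
            rw [hU]; simp
        _ = Uᵀ * (U * diagonal hC.eigenvalues * Uᵀ) * U := by simp only [mul_assoc]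
        _ = _ := by rw [← h]
    rw [← diag_diagonal hC.eigenvalues, this]
    simp [mul_add, add_mul, diag_add, diag_smul]
  rw [specFn_eq_eigenvalues hθ hC, h1, hp, hq]
  have hA' : (diag (Uᵀ * A * U), p) ∈ EpigraphP θ :=
    (theta_diag_conj_le_specFn hθ hU hA).trans hp.le
  have hB' : (diag (Uᵀ * B * U), q) ∈ EpigraphP θ :=
    (theta_diag_conj_le_specFn hθ hU hB).trans hq.le
  have := hθ.poly.convex_epigraph hA' hB' ha hb hab
  simpa [EpigraphP] using this

theorem mem_MSubdiff_finite (hθ : IsSymmPolyhedral θ) {X Y : Mat n}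
    (hY : Y ∈ MSubdiff (specFn θ) X) : X.IsHermitian ∧ ∃ r : ℝ, specFn θ X = r := by
  have hne : specFn θ X ≠ ⊤ := by
    intro htop
    obtain ⟨x, hx⟩ := hθ.exists_ne_top
    have h1 := hY.2 _ (isHermitian_orthogonal_diagonal 1 x)
    rw [specFn_orthogonal_diagonal hθ (by simp) x, htop, EReal.top_add_coe, top_le_iff] at h1
    exact hx h1
  refine ⟨?_, EReal.exists_coe_eq (specFn_ne_bot hθ X) hne⟩
  by_contra hX
  exact hne (if_neg hX)

end Spectral

theorem exists_orthogonal_curve {n : ℕ} {W : Mat n} (hW : Wᵀ = -W) :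
    ∃ (V : ℝ → Mat n) (G : Mat n → ℝ → Mat n),
      (∀ᶠ t in 𝓝 0, (V t)ᵀ * V t = 1 ∧
        ∀ B, V t * B * (V t)ᵀ = B + t • (W * B - B * W) + t ^ 2 • G B t) ∧
      ∀ B, Tendsto (G B) (𝓝 0)
        (𝓝 ((1 / 2 : ℝ) • (W * (W * B - B * W) - (W * B - B * W) * W))) := by
  let A : ℝ → Mat n := fun t => 1 - (t / 2) • W
  let A' : ℝ → Mat n := fun t => 1 + (t / 2) • W
  have hAT : ∀ t, (A t)ᵀ = A' t := fun t => by simp [A, A', hW]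
  have hA'T : ∀ t, (A' t)ᵀ = A t := fun t => by rw [← hAT, Matrix.transpose_transpose]
  have hcomm : ∀ t, A' t * A t = A t * A' t := fun t => by
    simp only [A, A', mul_add, add_mul, mul_sub, sub_mul, mul_one, one_mul]; abel
  have hA : Continuous A := by fun_prop
  have hA0 : A 0 = 1 := by simp [A]
  have hinv : ContinuousAt (fun t => (A t)⁻¹) 0 := by
    simp only [Matrix.inv_def, Ring.inverse_eq_inv']
    refine ContinuousAt.smul (ContinuousAt.inv₀ hA.matrix_det.continuousAt ?_)
      hA.matrix_adjugate.continuousAt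
    simp [hA0]
  have hdet : ∀ᶠ t in 𝓝 (0 : ℝ), (A t).det ≠ 0 :=
    hA.matrix_det.continuousAt.eventually_ne (by simp [hA0])
  refine ⟨fun t => (A t)⁻¹ * A' t, fun B t => (A t)⁻¹ *
    ((1 / 2 : ℝ) • (W * (W * B - B * W) - (W * B - B * W) * W) +
      (t / 4) • (W * (W * B - B * W) * W)) * ((A t)⁻¹)ᵀ, ?_, fun B => ?_⟩
  · filter_upwards [hdet] with t ht
    have hI : (A t)⁻¹ * A t = 1 := Matrix.nonsing_inv_mul _ (isUnit_iff_ne_zero.2 ht)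
    have hI' : A' t * ((A t)⁻¹)ᵀ = 1 := by
      rw [← hAT, ← Matrix.transpose_mul, hI, Matrix.transpose_one]
    have hcancel : ∀ M, (A t)⁻¹ * (A t * M * A' t) * ((A t)⁻¹)ᵀ = M := fun M => by
      calc (A t)⁻¹ * (A t * M * A' t) * ((A t)⁻¹)ᵀ
          = ((A t)⁻¹ * A t) * M * (A' t * ((A t)⁻¹)ᵀ) := by simp only [mul_assoc]
        _ = M := by rw [hI, hI', one_mul, mul_one]
    constructor
    · apply mul_eq_one_comm.mp
      rw [Matrix.transpose_mul, hA'T]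
      calc (A t)⁻¹ * A' t * (A t * ((A t)⁻¹)ᵀ)
          = (A t)⁻¹ * (A' t * A t) * ((A t)⁻¹)ᵀ := by simp only [mul_assoc]
        _ = 1 := by
          rw [hcomm]; simpa using hcancel 1
    · intro B
      have key : A' t * B * A t = A t * (B + t • (W * B - B * W)) * A' t +
          t ^ 2 • ((1 / 2 : ℝ) • (W * (W * B - B * W) - (W * B - B * W) * W) +
            (t / 4) • (W * (W * B - B * W) * W)) := by
        simp only [A, A', mul_add, add_mul, mul_sub, sub_mul, smul_mul_assoc, mul_smul_comm,
          mul_one, one_mul, ← mul_assoc]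
        module
      rw [Matrix.transpose_mul, hA'T]
      calc (A t)⁻¹ * A' t * B * (A t * ((A t)⁻¹)ᵀ)
          = (A t)⁻¹ * (A' t * B * A t) * ((A t)⁻¹)ᵀ := by simp only [mul_assoc]
        _ = _ := by
          rw [key, mul_add, add_mul, hcancel, mul_smul_comm, smul_mul_assoc]
  · have h1 : ContinuousAt (fun t => (A t)⁻¹ *
        ((1 / 2 : ℝ) • (W * (W * B - B * W) - (W * B - B * W) * W) +
          (t / 4) • (W * (W * B - B * W) * W)) * ((A t)⁻¹)ᵀ) 0 := by
      refine ContinuousAt.mul (ContinuousAt.mul hinv ?_) ?_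
      · exact Continuous.continuousAt (by fun_prop)
      · exact (Continuous.matrix_transpose continuous_id).continuousAt.comp hinv
    have h2 := h1.tendsto
    simpa [hA0] using h2

theorem exists_commutator_inverse_diagonal {n : ℕ} (x : Fin n → ℝ) :
    ∃ W : Mat n →ₗ[ℝ] Mat n, ∀ H : Mat n,
      (Hᵀ = H → (W H)ᵀ = -W H) ∧
      Commute (H - (W H * diagonal x - diagonal x * W H)) (diagonal x) ∧
      ∀ Q, Commute Q (diagonal x) → (W H * Q).trace = 0 := by
  refine ⟨{ toFun := fun H => Matrix.of fun i j => H i j * (x j - x i)⁻¹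
            map_add' := fun A B => by ext i j; simp [add_mul]
            map_smul' := fun a A => by ext i j; simp [mul_assoc] }, fun H => ⟨?_, ?_, ?_⟩⟩
  · intro hH
    ext i j
    have : H j i = H i j := congrFun (congrFun hH i) j
    simp only [LinearMap.coe_mk, AddHom.coe_mk, transpose_apply, of_apply, Matrix.neg_apply, this]
    rw [← neg_sub (x j) (x i), inv_neg, mul_neg]
  · ext i j
    simp only [LinearMap.coe_mk, AddHom.coe_mk, Matrix.mul_diagonal, Matrix.diagonal_mul,
      Matrix.sub_apply, of_apply]
    by_cases h : x j - x i = 0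
    · have : x j = x i := sub_eq_zero.1 h
      rw [this]; ring
    · field_simp
      ring
  · intro Q hQ
    rw [Matrix.trace]
    refine Finset.sum_eq_zero fun i _ => ?_
    rw [diag_apply, Matrix.mul_apply]
    refine Finset.sum_eq_zero fun j _ => ?_
    have := congrFun (congrFun hQ.eq j) i
    rw [Matrix.mul_diagonal, Matrix.diagonal_mul] at this
    simp only [LinearMap.coe_mk, AddHom.coe_mk, of_apply]
    by_cases h : x j - x i = 0
    · simp [h]
    · have : Q j i * (x j - x i) = 0 := by linarith
      rw [(mul_eq_zero.1 this).resolve_right h, mul_zero]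

/-- A linear inverse of `W ↦ W * X - X * W` modulo the commutant of `X`. -/
theorem exists_commutator_inverse {n : ℕ} {X : Mat n} (hX : X.IsHermitian) :
    ∃ W : Mat n →ₗ[ℝ] Mat n, ∀ H : Mat n,
      (Hᵀ = H → (W H)ᵀ = -W H) ∧
      Commute (H - (W H * X - X * W H)) X ∧
      ∀ Q, Commute Q X → (W H * Q).trace = 0 := by
  obtain ⟨U, hU, h⟩ := exists_orthogonal_diagonalization hX
  generalize hX.eigenvalues = x at h
  have hU' : U * Uᵀ = 1 := mul_eq_one_comm.mp hU
  obtain ⟨W, hW⟩ := exists_commutator_inverse_diagonal x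
  let c : Mat n →ₗ[ℝ] Mat n := LinearMap.mulRight ℝ Uᵀ ∘ₗ LinearMap.mulLeft ℝ U
  let c' : Mat n →ₗ[ℝ] Mat n := LinearMap.mulRight ℝ U ∘ₗ LinearMap.mulLeft ℝ Uᵀ
  have hc : ∀ A, c A = U * A * Uᵀ := fun A => rfl
  have hc' : ∀ A, c' A = Uᵀ * A * U := fun A => rfl
  have hcc' : ∀ A, c (c' A) = A := fun A => by
    rw [hc, hc']
    calc U * (Uᵀ * A * U) * Uᵀ = (U * Uᵀ) * A * (U * Uᵀ) := by simp only [mul_assoc]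
      _ = A := by rw [hU', one_mul, mul_one]
  have hmul : ∀ A B, c A * c B = c (A * B) := fun A B => by
    rw [hc, hc, hc]
    calc U * A * Uᵀ * (U * B * Uᵀ) = U * A * (Uᵀ * U) * B * Uᵀ := by simp only [mul_assoc]
      _ = _ := by rw [hU, mul_one]; simp only [mul_assoc]
  have hinj : Function.Injective c := by
    intro A B hAB
    have h2 : ∀ A, c' (c A) = A := fun A => by
      rw [hc, hc']
      calc Uᵀ * (U * A * Uᵀ) * U = (Uᵀ * U) * A * (Uᵀ * U) := by simp only [mul_assoc]
        _ = A := by rw [hU, one_mul, mul_one]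
    rw [← h2 A, hAB, h2]
  have hX' : X = c (diagonal x) := h
  refine ⟨c ∘ₗ W ∘ₗ c', fun H => ?_⟩
  obtain ⟨h1, h2, h3⟩ := hW (c' H)
  refine ⟨fun hH => ?_, ?_, fun Q hQ => ?_⟩
  · have : (c' H)ᵀ = c' H := by
      rw [hc']; simp [Matrix.transpose_mul, hH, mul_assoc]
    have h1' := h1 this
    simp only [LinearMap.comp_apply]
    rw [hc, Matrix.transpose_mul, Matrix.transpose_mul, h1', Matrix.transpose_transpose]
    simp [mul_assoc]
  · simp only [LinearMap.comp_apply]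
    have hP : H - (c (W (c' H)) * X - X * c (W (c' H))) =
        c (c' H - (W (c' H) * diagonal x - diagonal x * W (c' H))) := by
      rw [hX', hmul, hmul, map_sub, map_sub, hcc']
    rw [hP, hX']
    change _ * _ = _ * _
    rw [hmul, hmul, h2.eq]
  · simp only [LinearMap.comp_apply]
    have hQ' : Commute (c' Q) (diagonal x) := by
      apply hinj
      rw [← hmul, ← hmul, hcc', ← hX']
      exact hQ.eq
    have h4 := h3 _ hQ'
    rw [← hcc' Q, hmul, hc, mul_assoc, Matrix.trace_mul_comm, mul_assoc, hU, mul_one]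
    exact h4

theorem exists_simultaneous_diagonalization {n : ℕ} {X Q : Mat n} (hX : X.IsHermitian)
    (hQ : Q.IsHermitian) (hXQ : Commute X Q) :
    ∃ (V : Mat n) (x q : Fin n → ℝ), Vᵀ * V = 1 ∧ X = V * diagonal x * Vᵀ ∧
      Q = V * diagonal q * Vᵀ := by
  have hA : (Matrix.toEuclideanLin X).IsSymmetric := Matrix.isSymmetric_toEuclideanLin_iff.2 hX
  have hB : (Matrix.toEuclideanLin Q).IsSymmetric := Matrix.isSymmetric_toEuclideanLin_iff.2 hQ
  have hAB : Commute (Matrix.toEuclideanLin X) (Matrix.toEuclideanLin Q) := by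
    ext v i
    have : X *ᵥ (Q *ᵥ v.ofLp) = Q *ᵥ (X *ᵥ v.ofLp) := by
      rw [Matrix.mulVec_mulVec, Matrix.mulVec_mulVec, hXQ.eq]
    simpa [Matrix.toEuclideanLin, Matrix.toLpLin_apply] using congrFun this i
  have hsub := hA.directSum_isInternal_of_commute hB hAB
  have hfin := WellFoundedGT.finite_ne_bot_of_iSupIndep hsub.submodule_iSupIndep
  have hinternal := DirectSum.isInternal_ne_bot_iff.2 hsub
  have horth := (LinearMap.IsSymmetric.orthogonalFamily_eigenspace_inf_eigenspace hA hB).comp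
    (Subtype.val_injective (p := fun i : ℝ × ℝ =>
      Module.End.eigenspace (Matrix.toEuclideanLin X) i.2 ⊓
        Module.End.eigenspace (Matrix.toEuclideanLin Q) i.1 ≠ ⊥))
  have : Fintype {i : ℝ × ℝ // Module.End.eigenspace (Matrix.toEuclideanLin X) i.2 ⊓
        Module.End.eigenspace (Matrix.toEuclideanLin Q) i.1 ≠ ⊥} := hfin.fintype
  have hn : Module.finrank ℝ (EuclideanSpace ℝ (Fin n)) = n := by simp
  let b := hinternal.subordinateOrthonormalBasis hn horth
  let ev : Fin n → ℝ × ℝ := fun j => (hinternal.subordinateOrthonormalBasisIndex hn j horth).1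
  have hb : ∀ j, b j ∈ Module.End.eigenspace (Matrix.toEuclideanLin X) (ev j).2 ⊓
      Module.End.eigenspace (Matrix.toEuclideanLin Q) (ev j).1 := fun j =>
    hinternal.subordinateOrthonormalBasis_subordinate hn j horth
  have hV : (Matrix.of fun i j => b j i : Mat n)ᵀ * (Matrix.of fun i j => b j i) = 1 := by
    ext i j
    have := orthonormal_iff_ite.1 b.orthonormal j i
    simp only [PiLp.inner_apply, RCLike.inner_apply, conj_trivial] at this
    simp only [Matrix.mul_apply, transpose_apply, of_apply, this, Matrix.one_apply, eq_comm]
  have hV' := mul_eq_one_comm.mp hV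
  have hdiag : ∀ (M : Mat n) (d : Fin n → ℝ),
      (∀ j, b j ∈ Module.End.eigenspace (Matrix.toEuclideanLin M) (d j)) →
      M = (Matrix.of fun i j => b j i) * diagonal d * (Matrix.of fun i j => b j i)ᵀ := by
    intro M d hd
    have : M * (Matrix.of fun i j => b j i) = (Matrix.of fun i j => b j i) * diagonal d := by
      ext i j
      have h1 := congrArg (fun v : EuclideanSpace ℝ (Fin n) => v i)
        (Module.End.mem_eigenspace_iff.1 (hd j))
      simp only [PiLp.smul_apply, smul_eq_mul] at h1
      rw [Matrix.mul_diagonal, Matrix.mul_apply, of_apply, mul_comm, ← h1]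
      simp [Matrix.toEuclideanLin, Matrix.toLpLin_apply, Matrix.mulVec, dotProduct]
    rw [← this, mul_assoc, hV', mul_one]
  exact ⟨_, fun j => (ev j).2, fun j => (ev j).1, hV, hdiag X _ fun j => (hb j).1,
    hdiag Q _ fun j => (hb j).2⟩

theorem frob_self_nonneg {n : ℕ} (A : Mat n) : 0 ≤ frob A A := by
  simp only [frob, Matrix.trace, diag_apply, Matrix.mul_apply, transpose_apply]
  exact Finset.sum_nonneg fun i _ => Finset.sum_nonneg fun j _ => mul_self_nonneg _

theorem frob_self_eq_zero {n : ℕ} {A : Mat n} (h : frob A A = 0) : A = 0 := by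
  have := Matrix.trace_conjTranspose_mul_self_eq_zero_iff (A := A)
  rw [Matrix.conjTranspose_eq_transpose_of_trivial] at this
  exact this.1 h

theorem trace_mul_commutator {n : ℕ} (A B C : Mat n) :
    (A * (B * C - C * B)).trace = (B * (C * A - A * C)).trace := by
  rw [mul_sub, mul_sub, Matrix.trace_sub, Matrix.trace_sub, ← mul_assoc, ← mul_assoc, ← mul_assoc,
    ← mul_assoc, Matrix.trace_mul_cycle B C A, Matrix.trace_mul_cycle A C B]

theorem commute_commutator {n : ℕ} {A B X : Mat n} (hA : Commute A X) (hB : Commute B X) :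
    Commute (A * B - B * A) X :=
  (hA.mul_left hB).sub_left (hB.mul_left hA)

section Variational

variable {n : ℕ} {θ : (Fin n → ℝ) → EReal}

theorem MSubdiff_real_le {X Z : Mat n} {r : ℝ} (hr : specFn θ X = r)
    (hZ : Z ∈ MSubdiff (specFn θ) X) (A : Mat n) :
    ((r + frob Z (A - X) : ℝ) : EReal) ≤ specFn θ A := by
  by_cases hA : A.IsHermitian
  · have := hZ.2 A hA
    rw [hr] at this
    exact_mod_cast this
  · rw [specFn, if_neg hA]
    exact le_top

theorem commute_of_mem_MSubdiff (hθ : IsSymmPolyhedral θ) {X Y : Mat n}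
    (hY : Y ∈ MSubdiff (specFn θ) X) : Commute Y X := by
  obtain ⟨hX, r, hr⟩ := mem_MSubdiff_finite hθ hY
  have hXT := hX.transpose_eq'
  have hYT := hY.1.transpose_eq'
  set W := Y * X - X * Y with hWdef
  have hW : Wᵀ = -W := by simp [hWdef, Matrix.transpose_mul, hXT, hYT]
  obtain ⟨V, G, hVG, hG⟩ := exists_orthogonal_curve hW
  have h1 : ∀ᶠ t : ℝ in 𝓝[>] 0, frob Y (W * X - X * W) + t * frob Y (G X t) ≤ 0 := by
    filter_upwards [hVG.filter_mono nhdsWithin_le_nhds, self_mem_nhdsWithin]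
      with t ht (hpos : 0 < t)
    have h2 := MSubdiff_real_le hr hY (V t * X * (V t)ᵀ)
    rw [specFn_conj hθ ht.1 hX, hr, EReal.coe_le_coe_iff, ht.2 X, add_assoc, add_sub_cancel_left,
      frob_add_right, frob_smul_right, frob_smul_right] at h2
    have h3 : t * (frob Y (W * X - X * W) + t * frob Y (G X t)) ≤ 0 := by linarith
    exact nonpos_of_mul_nonpos_right h3 hpos
  have h2 : Tendsto (fun t : ℝ => frob Y (W * X - X * W) + t * frob Y (G X t)) (𝓝[>] 0)
      (𝓝 (frob Y (W * X - X * W) +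
        0 * frob Y ((1 / 2 : ℝ) • (W * (W * X - X * W) - (W * X - X * W) * W)))) := by
    have h3 := (continuous_frob.tendsto (Y, _)).comp (tendsto_const_nhds.prodMk_nhds (hG X))
    exact (tendsto_const_nhds.add (tendsto_id.mul h3)).mono_left nhdsWithin_le_nhds
  have h3 := le_of_tendsto h2 h1
  rw [zero_mul, add_zero, frob_eq_trace_mul hYT, trace_mul_commutator] at h3
  have h4 : (W * (X * Y - Y * X)).trace = frob W W := by
    rw [frob, hW, ← neg_sub (Y * X) (X * Y), neg_mul, mul_neg]
  rw [h4] at h3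
  have h5 := frob_self_eq_zero (le_antisymm h3 (frob_self_nonneg W))
  exact sub_eq_zero.1 h5

theorem conj_diagonal_mem_MSubdiff (hθ : IsSymmPolyhedral θ) {V : Mat n} (hV : Vᵀ * V = 1)
    {x z : Fin n → ℝ} {r : ℝ} (hx : θ x = r)
    (hz : ∀ u (s : ℝ), θ u ≤ s → r + z ⬝ᵥ (u - x) ≤ s) :
    V * diagonal z * Vᵀ ∈ MSubdiff (specFn θ) (V * diagonal x * Vᵀ) := by
  refine ⟨isHermitian_orthogonal_diagonal V z, fun Z hZ => ?_⟩
  rw [specFn_orthogonal_diagonal hθ hV, hx]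
  refine EReal.le_of_forall_real_ge (specFn_ne_bot hθ Z) fun s hs => ?_
  have h1 := hz _ s ((theta_diag_conj_le_specFn hθ hV hZ).trans hs)
  have h2 : diag (Vᵀ * (V * diagonal x * Vᵀ) * V) = x := by
    calc diag (Vᵀ * (V * diagonal x * Vᵀ) * V)
        = diag ((Vᵀ * V) * diagonal x * (Vᵀ * V)) := by simp only [mul_assoc]
      _ = x := by rw [hV]; simp
  rw [frob_conj, frob_diagonal_left, mul_sub, sub_mul, diag_sub, h2]
  exact_mod_cast h1

theorem eventually_specFn_add_smul_le (hθ : IsSymmPolyhedral θ) {X Y P : Mat n} {r c : ℝ}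
    (hr : specFn θ X = r) (hY : Y ∈ MSubdiff (specFn θ) X) (hP : P.IsHermitian)
    (hcomm : Commute P X) (hc : ∀ Z ∈ MSubdiff (specFn θ) X, frob Z P ≤ c) :
    ∀ᶠ t : ℝ in 𝓝[>] 0, specFn θ (X + t • P) ≤ ((r + t * c : ℝ) : EReal) := by
  obtain ⟨hX, -⟩ := mem_MSubdiff_finite hθ hY
  obtain ⟨V, x, p, hV, rfl, rfl⟩ := exists_simultaneous_diagonalization hX hP hcomm.symm
  have hx : θ x = r := by rw [← hr, specFn_orthogonal_diagonal hθ hV]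
  have hdiag : ∀ q : Fin n → ℝ, diag (Vᵀ * (V * diagonal q * Vᵀ) * V) = q := fun q => by
    calc diag (Vᵀ * (V * diagonal q * Vᵀ) * V)
        = diag ((Vᵀ * V) * diagonal q * (Vᵀ * V)) := by simp only [mul_assoc]
      _ = q := by rw [hV]; simp
  have hsum : ∀ (t : ℝ), V * diagonal x * Vᵀ + t • (V * diagonal p * Vᵀ) =
      V * diagonal (x + t • p) * Vᵀ := fun t => by
    rw [← smul_mul_assoc, ← mul_smul_comm, ← add_mul, ← mul_add, ← diagonal_smul, diagonal_add]
    rfl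
  simp_rw [hsum, specFn_orthogonal_diagonal hθ hV]
  refine hθ.poly.eventually_le_of_subgradient (y := diag (Vᵀ * Y * V)) hx ?_ ?_
  · intro u s hs
    have h1 := (MSubdiff_real_le hr hY (V * diagonal u * Vᵀ)).trans
      ((specFn_orthogonal_diagonal hθ hV u).trans_le hs)
    rw [EReal.coe_le_coe_iff, frob_sub_right, frob_comm Y, frob_comm Y, frob_conj, frob_conj,
      frob_diagonal_left, frob_diagonal_left] at h1
    rw [dotProduct_sub, dotProduct_comm _ u, dotProduct_comm _ x]
    exact h1
  · intro z hz
    have h1 := hc _ (conj_diagonal_mem_MSubdiff hθ hV hx hz)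
    rwa [frob_conj, frob_diagonal_left, hdiag] at h1

theorem le_liminf_of_tendsto {α : Type*} {F : Filter α} [F.NeBot] {f φ : α → EReal} {c : EReal}
    (hφ : Tendsto φ F (𝓝 c)) (h : ∀ᶠ q in F, φ q ≤ f q) : c ≤ liminf f F := by
  rw [← hφ.liminf_eq]
  exact liminf_le_liminf h

theorem liminf_le_of_tendsto_comp {α β : Type*} {F : Filter α} {l : Filter β} [l.NeBot]
    {f : α → EReal} {q : β → α} {φ : β → EReal} {c : EReal} (hq : Tendsto q l F)
    (hφ : Tendsto φ l (𝓝 c)) (h : ∀ᶠ t in l, f (q t) ≤ φ t) : liminf f F ≤ c := by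
  rw [← hφ.liminf_eq]
  calc liminf f F ≤ liminf f (map q l) := liminf_le_liminf_of_le hq
    _ = liminf (f ∘ q) l := rfl
    _ ≤ liminf φ l := liminf_le_liminf h

/-- The data of the second-order expansion: `W` inverts the commutator with `X` modulo the
commutant of `X`. -/
structure IsCommutatorInverse (X : Mat n) (W : Mat n →ₗ[ℝ] Mat n) : Prop where
  transpose_eq : ∀ H : Mat n, Hᵀ = H → (W H)ᵀ = -W H
  commute : ∀ H : Mat n, Commute (H - (W H * X - X * W H)) X
  trace_mul_eq_zero : ∀ H Q : Mat n, Commute Q X → (W H * Q).trace = 0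

theorem exists_recovery_curve (hθ : IsSymmPolyhedral θ) {X Y H : Mat n} {r : ℝ}
    {W : Mat n →ₗ[ℝ] Mat n} (hW : IsCommutatorInverse X W)
    (hr : specFn θ X = r) (hY : Y ∈ MSubdiff (specFn θ) X) (hH : H.IsHermitian)
    (hN : ∀ Z ∈ MSubdiff (specFn θ) X, frob H (Z - Y) ≤ 0) :
    ∃ (R : ℝ → Mat n) (R₀ : Mat n), Tendsto R (𝓝[>] 0) (𝓝 R₀) ∧
      frob Y R₀ = -(1 / 2) * frob (W H * Y - Y * W H) H ∧
      ∀ᶠ t : ℝ in 𝓝[>] 0,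
        specFn θ (X + t • (H + t • R t)) ≤ ((r + t * frob Y H : ℝ) : EReal) := by
  obtain ⟨hX, -⟩ := mem_MSubdiff_finite hθ hY
  have hXT := hX.transpose_eq'
  have hYT := hY.1.transpose_eq'
  have hHT := hH.transpose_eq'
  have hWT := hW.transpose_eq H hHT
  have hPX := hW.commute H
  have htr := hW.trace_mul_eq_zero H
  generalize W H = K at *
  set P := H - (K * X - X * K) with hPdef
  have hKX : K * X - X * K = H - P := by rw [hPdef]; abel
  have hP : P.IsHermitian := by
    rw [isHermitian_iff_transpose, hPdef]
    simp only [Matrix.transpose_sub, Matrix.transpose_mul, hXT, hHT, hWT]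
    noncomm_ring
  have hfrob : ∀ Z ∈ MSubdiff (specFn θ) X, frob Z P = frob Z H := fun Z hZ => by
    have hZX := commute_of_mem_MSubdiff hθ hZ
    rw [hPdef, frob_sub_right, frob_eq_trace_mul hZ.1.transpose_eq' (K * X - X * K),
      trace_mul_commutator, hZX.eq]
    simp
  have hgrow := eventually_specFn_add_smul_le (c := frob Y H) hθ hr hY hP hPX (fun Z hZ => by
    rw [hfrob Z hZ, frob_comm Z, frob_comm Y]
    have := hN Z hZ
    rw [frob_sub_right] at this
    linarith)
  obtain ⟨V, G, hVG, hG⟩ := exists_orthogonal_curve hWT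
  refine ⟨fun t => G X t + (K * P - P * K) + t • G P t,
    (1 / 2 : ℝ) • (K * (K * X - X * K) - (K * X - X * K) * K) + (K * P - P * K) +
      (0 : ℝ) • ((1 / 2 : ℝ) • (K * (K * P - P * K) - (K * P - P * K) * K)), ?_, ?_, ?_⟩
  · exact ((((hG X).add tendsto_const_nhds).add (tendsto_id.smul (hG P)))).mono_left
      nhdsWithin_le_nhds
  · have h1 : frob Y (K * P - P * K) = 0 := by
      rw [frob_eq_trace_mul hYT, trace_mul_commutator]
      exact htr _ (commute_commutator hPX (commute_of_mem_MSubdiff hθ hY))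
    have h2 : K * (H - P) - (H - P) * K = (K * H - H * K) - (K * P - P * K) := by noncomm_ring
    have h3 : (K * Y - Y * K)ᵀ = K * Y - Y * K := by
      simp only [Matrix.transpose_sub, Matrix.transpose_mul, hYT, hWT]
      noncomm_ring
    have h4 : frob Y (K * H - H * K) = - frob (K * Y - Y * K) H := by
      rw [frob_eq_trace_mul hYT, frob_eq_trace_mul h3, trace_mul_commutator, trace_mul_commutator,
        Matrix.trace_mul_comm, ← neg_sub, neg_mul, Matrix.trace_neg]
    rw [zero_smul, add_zero, frob_add_right, h1, frob_smul_right, hKX, h2, frob_sub_right, h1, h4]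
    ring
  · filter_upwards [hgrow, hVG.filter_mono nhdsWithin_le_nhds] with t h1 ht
    have hXP : (X + t • P).IsHermitian := by
      rw [isHermitian_iff_transpose]
      simp [hXT, hP.transpose_eq']
    have h2 : X + t • (H + t • (G X t + (K * P - P * K) + t • G P t)) =
        V t * (X + t • P) * (V t)ᵀ := by
      rw [mul_add, add_mul, mul_smul_comm, smul_mul_assoc, ht.2 X, ht.2 P, hKX]
      module
    rw [h2, specFn_conj hθ ht.1 hXP]
    exact h1

theorem exists_second_order_minorant (hθ : IsSymmPolyhedral θ) {X Y H : Mat n} {r : ℝ}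
    {W : Mat n →ₗ[ℝ] Mat n} (hW : IsCommutatorInverse X W)
    (hr : specFn θ X = r) (hY : Y ∈ MSubdiff (specFn θ) X) (hH : H.IsHermitian) :
    ∃ ψ : ℝ × Mat n → ℝ,
      Tendsto ψ (𝓝[>] 0 ×ˢ 𝓝 H) (𝓝 (frob (W H * Y - Y * W H) H)) ∧
      ∀ᶠ q in 𝓝[>] (0 : ℝ) ×ˢ 𝓝 H,
        ((r + q.1 * frob Y q.2 + q.1 ^ 2 / 2 * ψ q : ℝ) : EReal) ≤ specFn θ (X + q.1 • q.2) := by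
  obtain ⟨hX, -⟩ := mem_MSubdiff_finite hθ hY
  have hXT := hX.transpose_eq'
  have hYT := hY.1.transpose_eq'
  have hYX := commute_of_mem_MSubdiff hθ hY
  have hWT := hW.transpose_eq H hH.transpose_eq'
  have hPX := hW.commute H
  have htr := hW.trace_mul_eq_zero H
  generalize W H = K at *
  obtain ⟨V, G, hVG, hG⟩ := exists_orthogonal_curve hWT
  set B := K * Y - Y * K with hB
  have hBT : Bᵀ = B := by
    simp only [hB, Matrix.transpose_sub, Matrix.transpose_mul, hYT, hWT]
    noncomm_ring
  refine ⟨fun q => 2 * frob (G Y q.1) X + 2 * frob B q.2 + 2 * q.1 * frob (G Y q.1) q.2, ?_, ?_⟩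
  · have hfst : Tendsto (fun q : ℝ × Mat n => q.1) (𝓝[>] 0 ×ˢ 𝓝 H) (𝓝 0) :=
      tendsto_fst.mono_right nhdsWithin_le_nhds
    have hsnd : Tendsto (fun q : ℝ × Mat n => q.2) (𝓝[>] (0 : ℝ) ×ˢ 𝓝 H) (𝓝 H) := tendsto_snd
    have hGq := (hG Y).comp hfst
    have h1 := (continuous_frob.tendsto (_, X)).comp (hGq.prodMk_nhds tendsto_const_nhds)
    have h2 := (continuous_frob.tendsto (B, H)).comp (tendsto_const_nhds.prodMk_nhds hsnd)
    have h3 := (continuous_frob.tendsto (_, H)).comp (hGq.prodMk_nhds hsnd)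
    have h4 := ((h1.const_mul 2).add (h2.const_mul 2)).add ((hfst.const_mul 2).mul h3)
    have h5 : (K * B - B * K)ᵀ = K * B - B * K := by
      simp only [Matrix.transpose_sub, Matrix.transpose_mul, hBT, hWT]
      noncomm_ring
    have h6 : (B * (H - (K * X - X * K))).trace = 0 := by
      rw [Matrix.trace_mul_comm, hB, trace_mul_commutator]
      exact htr _ (commute_commutator hYX hPX)
    have h7 : frob (K * B - B * K) X = - frob B H := by
      rw [frob_eq_trace_mul h5, frob_eq_trace_mul hBT, Matrix.trace_mul_comm, trace_mul_commutator,
        trace_mul_commutator]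
      rw [mul_sub, Matrix.trace_sub] at h6
      rw [← neg_sub, mul_neg, Matrix.trace_neg]
      linarith
    have h8 : 2 * frob ((1 / 2 : ℝ) • (K * B - B * K)) X + 2 * frob B H +
        2 * 0 * frob ((1 / 2 : ℝ) • (K * B - B * K)) H = frob B H := by
      rw [frob_smul_left, h7]
      ring
    rw [← h8]
    exact h4
  · have hev := hVG.filter_mono (nhdsWithin_le_nhds (s := Set.Ioi (0 : ℝ)))
    filter_upwards [hev.prod_inl (𝓝 H)] with q ht
    by_cases hA : (X + q.1 • q.2).IsHermitian
    · have hV' : V q.1 * (V q.1)ᵀ = 1 := mul_eq_one_comm.mp ht.1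
      have h1 := MSubdiff_real_le hr hY ((V q.1)ᵀ * (X + q.1 • q.2) * V q.1)
      have h2 := specFn_conj hθ (V := (V q.1)ᵀ) (by rw [Matrix.transpose_transpose, hV']) hA
      rw [Matrix.transpose_transpose] at h2
      rw [h2, frob_sub_right, ← frob_conj, ht.2 Y, ← hB] at h1
      convert h1 using 2
      have h3 : frob B X = 0 := by
        rw [frob_eq_trace_mul hBT, Matrix.trace_mul_comm, hB, trace_mul_commutator, hYX.eq]
        simp
      simp only [frob_add_left, frob_add_right, frob_smul_left, frob_smul_right, h3]
      ring
    · rw [specFn, if_neg hA]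
      exact le_top

end Variational

section RelativeInterior

variable {E : Type*} [NormedAddCommGroup E] [NormedSpace ℝ E]

theorem exists_pos_sub_smul_mem_of_mem_intrinsicInterior {D : Set E} {y z : E}
    (hy : y ∈ intrinsicInterior ℝ D) (hz : z ∈ D) : ∃ ε : ℝ, 0 < ε ∧ y - ε • (z - y) ∈ D := by
  obtain ⟨a, ha, rfl⟩ := hy
  let c : ℝ → affineSpan ℝ D := fun t =>
    ⟨AffineMap.lineMap (a : E) z (-t), AffineMap.lineMap_mem _ a.2 (subset_affineSpan ℝ D hz)⟩
  have hc : Continuous c := Continuous.subtype_mk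
    (AffineMap.lineMap_continuous.comp continuous_neg) _
  have h0 : c 0 = a := by simp [c]
  have h1 : ∀ᶠ t in 𝓝[>] (0 : ℝ), c t ∈ ((↑) ⁻¹' D : Set (affineSpan ℝ D)) := by
    have h2 : Tendsto c (𝓝[>] 0) (𝓝 a) := by
      rw [← h0]
      exact (hc.tendsto 0).mono_left nhdsWithin_le_nhds
    exact h2.eventually (mem_interior_iff_mem_nhds.1 ha)
  obtain ⟨t, ht, hpos⟩ := (h1.and self_mem_nhdsWithin).exists
  refine ⟨t, hpos, ?_⟩
  have h3 : (a : E) - t • (z - a) = c t := by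
    simp only [c, AffineMap.lineMap_apply, vsub_eq_sub, vadd_eq_add, neg_smul]
    abel
  rw [h3]
  exact ht

theorem exists_separating_of_notMem_intrinsicInterior [FiniteDimensional ℝ E] {D : Set E} {y : E}
    (hD : Convex ℝ D) (hy : y ∈ D) (hy' : y ∉ intrinsicInterior ℝ D) :
    ∃ f : E →ₗ[ℝ] ℝ, (∀ z ∈ D, f z ≤ f y) ∧ ∃ z ∈ D, f z < f y := by
  have hyA := subset_affineSpan ℝ D hy
  let V := (affineSpan ℝ D).direction
  let K : Set V := {v | (v : E) + y ∈ D}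
  let toV : affineSpan ℝ D → V := fun a => ⟨a - y, AffineSubspace.vsub_mem_direction a.2 hyA⟩
  let ofV : V → affineSpan ℝ D := fun v =>
    ⟨v + y, AffineSubspace.vadd_mem_of_mem_direction v.2 hyA⟩
  have htoV : Continuous toV := (continuous_subtype_val.sub continuous_const).subtype_mk _
  have hofV : Continuous ofV := (continuous_subtype_val.add continuous_const).subtype_mk _
  have hK : Convex ℝ K := fun v hv w hw a b ha hb hab => by
    have h := hD hv hw ha hb hab
    have e : a • ((v : E) + y) + b • ((w : E) + y) = ((a • v + b • w : V) : E) + y := by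
      rw [smul_add, smul_add, add_add_add_comm, ← add_smul, hab, one_smul]
      rfl
    rw [e] at h
    exact h
  have hsub : toV ⁻¹' K ⊆ ((↑) ⁻¹' D : Set (affineSpan ℝ D)) := fun a ha => by
    simpa [toV, K] using ha
  have hzero : (0 : V) ∉ interior K := fun h => by
    refine hy' ⟨⟨y, hyA⟩, interior_mono hsub
      (preimage_interior_subset_interior_preimage htoV ?_), rfl⟩
    have e : toV ⟨y, hyA⟩ = 0 := Subtype.ext (sub_self y)
    rwa [Set.mem_preimage, e]
  have hne : (interior K).Nonempty := by
    obtain ⟨_, a, ha, rfl⟩ := Set.Nonempty.intrinsicInterior hD ⟨y, hy⟩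
    refine ⟨toV a, (preimage_interior_subset_interior_preimage hofV :
      ofV ⁻¹' interior ((↑) ⁻¹' D) ⊆ _) ?_⟩
    have e : ofV (toV a) = a := Subtype.ext (sub_add_cancel _ _)
    rwa [Set.mem_preimage, e]
  obtain ⟨f, hf⟩ := geometric_hahn_banach_open_point hK.interior isOpen_interior hzero
  rw [map_zero] at hf
  have hfK : ∀ v ∈ K, f v ≤ 0 := fun v hv => by
    have h : closure (interior K) ⊆ {v | f v ≤ 0} :=
      closure_minimal (fun v hv => (hf v hv).le) (isClosed_le f.continuous continuous_const)
    rw [hK.closure_interior_eq_closure_of_nonempty_interior hne] at h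
    exact h (subset_closure hv)
  obtain ⟨g, hg⟩ := LinearMap.exists_extend (f : V →ₗ[ℝ] ℝ)
  have hgf : ∀ v : V, g v = f v := fun v => LinearMap.congr_fun hg v
  refine ⟨g, fun z hz => ?_, ?_⟩
  · have h := hfK (toV ⟨z, subset_affineSpan ℝ D hz⟩) (by simpa [toV, K] using hz)
    rw [← hgf] at h
    simpa [toV] using h
  · obtain ⟨v, hv⟩ := hne
    refine ⟨(v : E) + y, interior_subset (s := K) hv, ?_⟩
    rw [map_add, hgf]
    linarith [hf v hv]

end RelativeInterior

theorem monotone_coe_mul_sub {c : ℝ} (hc : 0 ≤ c) (r : ℝ) :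
    Monotone fun e : EReal => (c : EReal) * (e - r) := fun _ _ h =>
  mul_le_mul_of_nonneg_left (EReal.sub_le_sub h le_rfl) (EReal.coe_nonneg.2 hc)

theorem monotone_coe_mul_sub_sub {c : ℝ} (hc : 0 ≤ c) (r s : ℝ) :
    Monotone fun e : EReal => (c : EReal) * (e - r - s) := fun _ _ h =>
  mul_le_mul_of_nonneg_left (EReal.sub_le_sub (EReal.sub_le_sub h le_rfl) le_rfl)
    (EReal.coe_nonneg.2 hc)

theorem exists_symmetric_frob_representation {n : ℕ} (f : Mat n →ₗ[ℝ] ℝ) :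
    ∃ H : Mat n, H.IsHermitian ∧ ∀ A : Mat n, A.IsHermitian → frob H A = f A := by
  let M : Mat n := Matrix.of fun i j => f (Matrix.single i j 1)
  have hM : ∀ A, frob M A = f A := fun A => by
    conv_rhs => rw [Matrix.matrix_eq_sum_single A]
    simp only [map_sum, frob, Matrix.trace, diag_apply, Matrix.mul_apply, transpose_apply]
    rw [Finset.sum_comm]
    refine Finset.sum_congr rfl fun i _ => Finset.sum_congr rfl fun j _ => ?_
    have h : Matrix.single i j (A i j) = A i j • Matrix.single i j (1 : ℝ) := by simp
    rw [h, map_smul, smul_eq_mul, mul_comm]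
    rfl
  refine ⟨(1 / 2 : ℝ) • (M + Mᵀ), ?_, fun A hA => ?_⟩
  · rw [isHermitian_iff_transpose]
    simp [add_comm]
  · have h : frob Mᵀ A = frob M A := by
      rw [frob, frob, Matrix.transpose_transpose, ← Matrix.trace_transpose, Matrix.transpose_mul,
        hA.transpose_eq', Matrix.trace_mul_comm]
    rw [frob_smul_left, frob_add_left, h, hM]
    ring

section SecondOrder

variable {n : ℕ} {θ : (Fin n → ℝ) → EReal}

theorem isClosed_isHermitian : IsClosed {A : Mat n | A.IsHermitian} :=
  isClosed_eq continuous_star continuous_id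

theorem convex_MSubdiff {X : Mat n} {r : ℝ} (hr : specFn θ X = r) :
    Convex ℝ (MSubdiff (specFn θ) X) := fun Y hY Z hZ a b ha hb hab => by
  refine ⟨?_, fun A hA => ?_⟩
  · rw [isHermitian_iff_transpose]
    simp [hY.1.transpose_eq', hZ.1.transpose_eq']
  · have h1 := MSubdiff_real_le hr hY A
    have h2 := MSubdiff_real_le hr hZ A
    rw [hr, ← EReal.coe_add]
    have h3 : a * frob Y (A - X) + b * frob Z (A - X) ≤ max (frob Y (A - X)) (frob Z (A - X)) := by
      simpa using Convex.combo_le_max (frob Y (A - X)) (frob Z (A - X)) ha hb hab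
    rw [frob_add_left, frob_smul_left, frob_smul_left]
    rcases le_max_iff.1 h3 with h | h
    · exact (EReal.coe_le_coe_iff.2 (add_le_add_right h r)).trans h1
    · exact (EReal.coe_le_coe_iff.2 (add_le_add_right h r)).trans h2

theorem tendsto_frob_snd (Z H : Mat n) :
    Tendsto (fun q : ℝ × Mat n => frob Z q.2) (𝓝[>] 0 ×ˢ 𝓝 H) (𝓝 (frob Z H)) := by
  have h : Continuous (frob Z) := by
    unfold frob
    fun_prop
  exact (h.tendsto H).comp tendsto_snd

theorem eventually_fst_pos (H : Mat n) : ∀ᶠ q : ℝ × Mat n in 𝓝[>] 0 ×ˢ 𝓝 H, 0 < q.1 :=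
  (eventually_mem_nhdsWithin (α := ℝ) (a := 0) (s := Set.Ioi 0)).prod_inl (𝓝 H)

theorem frob_le_MSubderiv {X Z : Mat n} {r : ℝ} (hr : specFn θ X = r)
    (hZ : Z ∈ MSubdiff (specFn θ) X) (H : Mat n) :
    ((frob Z H : ℝ) : EReal) ≤ MSubderiv (specFn θ) X H := by
  refine le_liminf_of_tendsto
    (continuous_coe_real_ereal.tendsto _ |>.comp (tendsto_frob_snd Z H)) ?_
  filter_upwards [eventually_fst_pos H] with q hq
  have h1 := monotone_coe_mul_sub (one_div_nonneg.2 hq.le) r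
    (MSubdiff_real_le hr hZ (X + q.1 • q.2))
  rw [hr]
  refine le_trans (le_of_eq ?_) h1
  simp only [Function.comp, ← EReal.coe_sub, ← EReal.coe_mul, EReal.coe_eq_coe_iff,
    add_sub_cancel_left, frob_smul_right]
  field_simp

theorem tendsto_recovery {R : ℝ → Mat n} {R₀ H : Mat n} (hR : Tendsto R (𝓝[>] 0) (𝓝 R₀)) :
    Tendsto (fun t : ℝ => (t, H + t • R t)) (𝓝[>] 0) (𝓝[>] 0 ×ˢ 𝓝 H) := by
  refine tendsto_id.prodMk ?_
  have h : Tendsto (fun t : ℝ => t) (𝓝[>] 0) (𝓝 0) := nhdsWithin_le_nhds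
  simpa using (tendsto_const_nhds (x := H)).add (h.smul hR)

theorem MCrit_specFn_eq (hθ : IsSymmPolyhedral θ) {X Y : Mat n} {r : ℝ}
    {W : Mat n →ₗ[ℝ] Mat n} (hW : IsCommutatorInverse X W) (hr : specFn θ X = r)
    (hY : Y ∈ MSubdiff (specFn θ) X) :
    MCrit (specFn θ) X Y =
      {H : Mat n | H.IsHermitian ∧ ∀ Z ∈ MSubdiff (specFn θ) X, frob H (Z - Y) ≤ 0} := by
  ext H
  refine and_congr_right fun hH => ⟨fun h Z hZ => ?_, fun hN => ?_⟩
  · have h1 := frob_le_MSubderiv hr hZ H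
    rw [← h, EReal.coe_le_coe_iff] at h1
    rw [frob_sub_right, frob_comm H, frob_comm H]
    linarith
  · refine le_antisymm (frob_le_MSubderiv hr hY H) ?_
    obtain ⟨R, R₀, hR, -, hle⟩ := exists_recovery_curve hθ hW hr hY hH hN
    refine liminf_le_of_tendsto_comp (tendsto_recovery hR)
      (φ := fun _ => ((frob Y H : ℝ) : EReal)) tendsto_const_nhds ?_
    filter_upwards [hle, self_mem_nhdsWithin] with t ht (hpos : 0 < t)
    have h1 := monotone_coe_mul_sub (one_div_nonneg.2 hpos.le) r ht
    rw [hr]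
    refine h1.trans (le_of_eq ?_)
    simp only [← EReal.coe_sub, ← EReal.coe_mul, EReal.coe_eq_coe_iff, add_sub_cancel_left]
    field_simp

theorem MSub2_specFn_eq_of_mem (hθ : IsSymmPolyhedral θ) {X Y H : Mat n} {r : ℝ}
    {W : Mat n →ₗ[ℝ] Mat n} (hW : IsCommutatorInverse X W) (hr : specFn θ X = r)
    (hY : Y ∈ MSubdiff (specFn θ) X) (hH : H.IsHermitian)
    (hN : ∀ Z ∈ MSubdiff (specFn θ) X, frob H (Z - Y) ≤ 0) :
    MSub2 (specFn θ) X Y H = ((frob (W H * Y - Y * W H) H : ℝ) : EReal) := by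
  refine le_antisymm ?_ ?_
  · obtain ⟨R, R₀, hR, hR₀, hle⟩ := exists_recovery_curve hθ hW hr hY hH hN
    have h1 : Tendsto (fun t => -2 * frob Y (R t)) (𝓝[>] 0)
        (𝓝 (frob (W H * Y - Y * W H) H)) := by
      have e : frob (W H * Y - Y * W H) H = -2 * frob Y R₀ := by rw [hR₀]; ring
      rw [e]
      exact ((continuous_frob.tendsto (Y, R₀)).comp (tendsto_const_nhds.prodMk_nhds hR)).const_mul _
    refine liminf_le_of_tendsto_comp (tendsto_recovery hR)
      ((continuous_coe_real_ereal.tendsto _).comp h1) ?_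
    filter_upwards [hle, self_mem_nhdsWithin] with t ht (hpos : 0 < t)
    have h2 := monotone_coe_mul_sub_sub (c := 2 / t ^ 2) (by positivity) r
      (t * frob Y (H + t • R t)) ht
    rw [hr]
    refine h2.trans (le_of_eq ?_)
    simp only [Function.comp, ← EReal.coe_sub, ← EReal.coe_mul, EReal.coe_eq_coe_iff,
      add_sub_cancel_left, frob_add_right, frob_smul_right]
    field_simp
    ring
  · obtain ⟨ψ, hψ, hle⟩ := exists_second_order_minorant hθ hW hr hY hH
    refine le_liminf_of_tendsto ((continuous_coe_real_ereal.tendsto _).comp hψ) ?_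
    filter_upwards [hle, eventually_fst_pos H] with q ht hpos
    have h2 := monotone_coe_mul_sub_sub (c := 2 / q.1 ^ 2) (by positivity) r
      (q.1 * frob Y q.2) ht
    rw [hr]
    refine le_trans (le_of_eq ?_) h2
    simp only [Function.comp, ← EReal.coe_sub, ← EReal.coe_mul, EReal.coe_eq_coe_iff]
    field_simp
    ring

theorem MSub2_specFn_eq_top_of_not_isHermitian {X Y H : Mat n} {r : ℝ} (hr : specFn θ X = r)
    (hX : X.IsHermitian) (hH : ¬ H.IsHermitian) : MSub2 (specFn θ) X Y H = ⊤ := by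
  refine top_le_iff.1 (le_liminf_of_tendsto (φ := fun _ => ⊤) tendsto_const_nhds ?_)
  have h1 : ∀ᶠ q : ℝ × Mat n in 𝓝[>] 0 ×ˢ 𝓝 H, ¬ q.2.IsHermitian := by
    have h : ∀ᶠ A : Mat n in 𝓝 H, ¬ A.IsHermitian :=
      isClosed_isHermitian.isOpen_compl.mem_nhds hH
    exact h.prod_inr _
  filter_upwards [h1, eventually_fst_pos H] with q hq hpos
  have h2 : ¬ (X + q.1 • q.2).IsHermitian := fun h => hq <| by
    have e : q.2 = q.1⁻¹ • ((X + q.1 • q.2) - X) := by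
      rw [add_sub_cancel_left, smul_smul, inv_mul_cancel₀ hpos.ne', one_smul]
    rw [e, isHermitian_iff_transpose, Matrix.transpose_smul, Matrix.transpose_sub,
      h.transpose_eq', hX.transpose_eq']
  rw [specFn, if_neg h2, hr, EReal.top_sub_coe, EReal.top_sub_coe,
    EReal.coe_mul_top_of_pos (by positivity)]

theorem MSub2_specFn_eq_top_of_frob_pos {X Y Z H : Mat n} {r : ℝ} (hr : specFn θ X = r)
    (hZ : Z ∈ MSubdiff (specFn θ) X) (hpos : 0 < frob H (Z - Y)) :
    MSub2 (specFn θ) X Y H = ⊤ := by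
  have h1 : Tendsto (fun q : ℝ × Mat n => q.1⁻¹ * (2 * frob (Z - Y) q.2)) (𝓝[>] 0 ×ˢ 𝓝 H)
      atTop := by
    refine (tendsto_inv_nhdsGT_zero.comp tendsto_fst).atTop_mul_pos (C := 2 * frob (Z - Y) H) ?_
      ((tendsto_frob_snd _ H).const_mul 2)
    rw [frob_comm]
    linarith
  refine top_le_iff.1 (le_liminf_of_tendsto (EReal.tendsto_coe_nhds_top_iff.2 h1) ?_)
  filter_upwards [eventually_fst_pos H] with q hq
  have h2 := monotone_coe_mul_sub_sub (c := 2 / q.1 ^ 2) (by positivity) r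
    (q.1 * frob Y q.2) (MSubdiff_real_le hr hZ (X + q.1 • q.2))
  rw [hr]
  refine le_trans (le_of_eq ?_) h2
  simp only [← EReal.coe_sub, ← EReal.coe_mul, EReal.coe_eq_coe_iff, add_sub_cancel_left,
    frob_smul_right, frob_sub_left]
  field_simp

theorem frob_commutator_comm {X Y : Mat n} {W : Mat n →ₗ[ℝ] Mat n} (hW : IsCommutatorInverse X W)
    (hY : Yᵀ = Y) (hYX : Commute Y X) {A B : Mat n} (hA : Aᵀ = A) (hB : Bᵀ = B) :
    frob (W A * Y - Y * W A) B = frob (W B * Y - Y * W B) A := by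
  have key : ∀ {A B : Mat n}, Aᵀ = A → Bᵀ = B → frob (W A * Y - Y * W A) B =
      (W A * (Y * (W B * X - X * W B) - (W B * X - X * W B) * Y)).trace := fun {A B} hA hB => by
    have h1 : (W A * Y - Y * W A)ᵀ = W A * Y - Y * W A := by
      rw [Matrix.transpose_sub, Matrix.transpose_mul, Matrix.transpose_mul, hY,
        hW.transpose_eq A hA]
      noncomm_ring
    have h2 : (B * (W A * Y - Y * W A)).trace = (W A * (Y * B - B * Y)).trace :=
      trace_mul_commutator _ _ _
    have h3 := hW.trace_mul_eq_zero A _ (commute_commutator hYX (hW.commute B))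
    rw [frob_eq_trace_mul h1, Matrix.trace_mul_comm, h2, ← sub_eq_zero, ← Matrix.trace_sub, ← h3]
    congr 1
    noncomm_ring
  rw [key hA hB, key hB hA]
  have e : ∀ S T : Mat n, (S * (Y * (T * X - X * T) - (T * X - X * T) * Y)).trace =
      (S * Y * T * X).trace - (S * (Y * X) * T).trace - (S * T * (X * Y)).trace +
        (S * X * T * Y).trace := fun S T => by
    simp only [← Matrix.trace_sub, ← Matrix.trace_add]
    congr 1
    noncomm_ring
  have c1 : ∀ S T : Mat n, (S * Y * T * X).trace = (T * X * S * Y).trace := fun S T => by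
    rw [mul_assoc (S * Y), Matrix.trace_mul_comm, ← mul_assoc]
  have c2 : ∀ S T : Mat n, (S * T * (X * Y)).trace = (T * (Y * X) * S).trace := fun S T => by
    rw [hYX.eq, mul_assoc, Matrix.trace_mul_comm]
  rw [e, e, c1, c1 (W B), c2, c2 (W B)]
  ring

end SecondOrder

section QuadraticForm

variable {n : ℕ} {θ : (Fin n → ℝ) → EReal}

theorem MSub2_specFn_ne_top_iff (hθ : IsSymmPolyhedral θ) {X Y H : Mat n} {r : ℝ}
    {W : Mat n →ₗ[ℝ] Mat n} (hW : IsCommutatorInverse X W) (hr : specFn θ X = r)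
    (hY : Y ∈ MSubdiff (specFn θ) X) :
    MSub2 (specFn θ) X Y H ≠ ⊤ ↔
      H.IsHermitian ∧ ∀ Z ∈ MSubdiff (specFn θ) X, frob H (Z - Y) ≤ 0 := by
  refine ⟨fun h => ⟨?_, fun Z hZ => ?_⟩, fun h => ?_⟩
  · by_contra hH
    exact h (MSub2_specFn_eq_top_of_not_isHermitian hr (mem_MSubdiff_finite hθ hY).1 hH)
  · by_contra hpos
    exact h (MSub2_specFn_eq_top_of_frob_pos hr hZ (not_le.1 hpos))
  · rw [MSub2_specFn_eq_of_mem hθ hW hr hY h.1 h.2]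
    exact EReal.coe_ne_top _

theorem isMGQF_MSub2_of_mem_intrinsicInterior (hθ : IsSymmPolyhedral θ) {X Y : Mat n} {r : ℝ}
    {W : Mat n →ₗ[ℝ] Mat n} (hW : IsCommutatorInverse X W) (hr : specFn θ X = r)
    (hY : Y ∈ MSubdiff (specFn θ) X)
    (hri : Y ∈ intrinsicInterior ℝ (MSubdiff (specFn θ) X)) :
    IsMGQF (MSub2 (specFn θ) X Y) := by
  have hN : ∀ H : Mat n, (∀ Z ∈ MSubdiff (specFn θ) X, frob H (Z - Y) ≤ 0) →
      ∀ Z ∈ MSubdiff (specFn θ) X, frob H (Z - Y) = 0 := fun H h Z hZ => by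
    obtain ⟨ε, hε, hmem⟩ := exists_pos_sub_smul_mem_of_mem_intrinsicInterior
      (E := Fin n → Fin n → ℝ) hri hZ
    have h1 : frob H ((Y - ε • (Z - Y)) - Y) ≤ 0 := h _ hmem
    rw [sub_sub_cancel_left, ← neg_smul, frob_smul_right] at h1
    refine le_antisymm (h Z hZ) ?_
    by_contra! hneg
    nlinarith
  let S : Submodule ℝ (Mat n) :=
    { carrier := {H | H.IsHermitian ∧ ∀ Z ∈ MSubdiff (specFn θ) X, frob H (Z - Y) = 0}
      add_mem' := fun {A B} hA hB => ⟨hA.1.add hB.1, fun Z hZ => by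
        rw [frob_add_left, hA.2 Z hZ, hB.2 Z hZ, add_zero]⟩
      zero_mem' := ⟨isHermitian_zero, fun Z _ => by simp [frob]⟩
      smul_mem' := fun c A hA => ⟨by
        rw [isHermitian_iff_transpose, Matrix.transpose_smul, hA.1.transpose_eq'], fun Z hZ => by
        rw [frob_smul_left, hA.2 Z hZ, mul_zero]⟩ }
  let L : Mat n →ₗ[ℝ] Mat n := (LinearMap.mulRight ℝ Y - LinearMap.mulLeft ℝ Y) ∘ₗ W
  have hL : ∀ A, L A = W A * Y - Y * W A := fun A => rfl
  refine ⟨S, L ∘ₗ S.subtype, fun A => A.2.1, fun A B => ?_, fun A => ?_⟩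
  · rw [frob_comm (A : Mat n)]
    exact frob_commutator_comm hW hY.1.transpose_eq' (commute_of_mem_MSubdiff hθ hY)
      A.2.1.transpose_eq' B.2.1.transpose_eq'
  · split_ifs with h
    · exact MSub2_specFn_eq_of_mem hθ hW hr hY h.1 fun Z hZ => (h.2 Z hZ).le
    · by_contra h1
      have h2 := (MSub2_specFn_ne_top_iff hθ hW hr hY).1 h1
      exact h ⟨h2.1, hN A h2.2⟩

theorem mem_intrinsicInterior_of_isMGQF_MSub2 (hθ : IsSymmPolyhedral θ) {X Y : Mat n} {r : ℝ}
    {W : Mat n →ₗ[ℝ] Mat n} (hW : IsCommutatorInverse X W) (hr : specFn θ X = r)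
    (hY : Y ∈ MSubdiff (specFn θ) X) (hq : IsMGQF (MSub2 (specFn θ) X Y)) :
    Y ∈ intrinsicInterior ℝ (MSubdiff (specFn θ) X) := by
  by_contra hri
  obtain ⟨S, L, -, -, hS⟩ := hq
  have hmem : ∀ H : Mat n, H ∈ S ↔
      H.IsHermitian ∧ ∀ Z ∈ MSubdiff (specFn θ) X, frob H (Z - Y) ≤ 0 := fun H => by
    rw [← MSub2_specFn_ne_top_iff hθ hW hr hY, hS]
    split_ifs with h <;> simp [h]
  obtain ⟨f, hle, Z, hZ, hlt⟩ := exists_separating_of_notMem_intrinsicInterior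
    (E := Fin n → Fin n → ℝ) (convex_MSubdiff hr) hY hri
  obtain ⟨H, hH, hf⟩ := exists_symmetric_frob_representation f
  have hHf : ∀ A ∈ MSubdiff (specFn θ) X, frob H (A - Y) = f A - f Y := fun A hA => by
    rw [frob_sub_right, hf A hA.1, hf Y hY.1]
    rfl
  have hHS : H ∈ S := (hmem H).2 ⟨hH, fun A hA => by
    rw [hHf A hA]
    exact sub_nonpos.2 (hle A hA)⟩
  have h1 := ((hmem (-H)).1 (S.neg_mem hHS)).2 Z hZ
  rw [← neg_one_smul ℝ H, frob_smul_left, hHf Z hZ] at h1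
  linarith

end QuadraticForm

theorem statement8 {n : ℕ} (θ : (Fin n → ℝ) → EReal)
    (hsym : ∀ (σ : Equiv.Perm (Fin n)) (x : Fin n → ℝ), θ (x ∘ σ) = θ x)
    (hpoly : PolyPi θ)
    (hproper : (∀ x, θ x ≠ ⊥) ∧ ∃ x, θ x ≠ ⊤) :
    ConvexMFn (specFn θ) ∧
    ∀ X Y : Mat n, Y ∈ MSubdiff (specFn θ) X →
      (MCrit (specFn θ) X Y =
        {H : Mat n | H.IsHermitian ∧ ∀ Z ∈ MSubdiff (specFn θ) X, frob H (Z - Y) ≤ 0}) ∧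
      (IsMGQF (MSub2 (specFn θ) X Y) ↔ Y ∈ intrinsicInterior ℝ (MSubdiff (specFn θ) X)) := by
  have hθ : IsSymmPolyhedral θ := ⟨hsym, hpoly, hproper.1, hproper.2⟩
  refine ⟨convexMFn_specFn hθ, fun X Y hY => ?_⟩
  obtain ⟨hX, r, hr⟩ := mem_MSubdiff_finite hθ hY
  obtain ⟨W, hW⟩ := exists_commutator_inverse hX
  have hW' : IsCommutatorInverse X W :=
    ⟨fun H => (hW H).1, fun H => (hW H).2.1, fun H => (hW H).2.2⟩
  exact ⟨MCrit_specFn_eq hθ hW' hr hY, mem_intrinsicInterior_of_isMGQF_MSub2 hθ hW' hr hY,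
    isMGQF_MSub2_of_mem_intrinsicInterior hθ hW' hr hY⟩

end
end

section
/- Let g = θ ∘ λ on Sⁿ with θ symmetric polyhedral convex, let (X, Y) ∈ gph ∂g with P ∈ Oⁿ(X) ∩ Oⁿ(Y), and let H ∈ C_g(X, Y). Then λ'(X; H) ∈ C_θ(λ(X), λ(Y)), where λ'(X; H) = (λ(P_{α¹}ᵀ H P_{α¹}), …, λ(P_{αʳ}ᵀ H P_{αʳ})) is the directional derivative of the eigenvalue map, with αˡ the blocks of equal eigenvalues of X. -/
/- STATEMENT 19: for g = θ∘λ with θ symmetric polyhedral convex,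
(X,Y) ∈ gph ∂g, P ∈ Oⁿ(X) ∩ Oⁿ(Y) and H in the critical cone C_g(X,Y), the
directional derivative λ'(X;H) (given blockwise by the ordered eigenvalues of
the compressed matrices (PᵀHP)_{αˡαˡ}) belongs to the critical cone
C_θ(λ(X), λ(Y)). -/

open Classical Matrix Filter Topology

noncomputable section

/-- Subderivative of θ : ℝⁿ → EReal at x in direction w. -/
def vSubderiv {n : ℕ} (θ : (Fin n → ℝ) → EReal) (x w : Fin n → ℝ) : EReal :=
  Filter.liminf
    (fun q : ℝ × (Fin n → ℝ) => (((1 / q.1 : ℝ)) : EReal) * (θ (x + q.1 • q.2) - θ x))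
    ((𝓝[>] (0 : ℝ)) ×ˢ 𝓝 w)

/-- Critical cone of θ at x for y. -/
def vCrit {n : ℕ} (θ : (Fin n → ℝ) → EReal) (x y : Fin n → ℝ) : Set (Fin n → ℝ) :=
  {w | ((y ⬝ᵥ w : ℝ) : EReal) = vSubderiv θ x w}

/-- The directional derivative λ'(X;H) of the eigenvalue map: the i-th entry is
the ordered eigenvalue, within the block {j : lamX j = lamX i}, of the
compression of M = PᵀHP to that block. -/
noncomputable def dirDeriv {n : ℕ} (lamX : Fin n → ℝ) (M : Mat n) (i : Fin n) : ℝ :=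
  let α : Finset (Fin n) := Finset.univ.filter (fun j => lamX j = lamX i)
  let e := α.orderIsoOfFin rfl
  eigs (Matrix.of fun p q : Fin α.card => M (e p) (e q))
    (e.symm ⟨i, Finset.mem_filter.mpr ⟨Finset.mem_univ i, rfl⟩⟩)

/-! ### Ordered spectral decompositions -/

theorem exists_perm_of_map_univ_eq {n : ℕ} {a b : Fin n → ℝ}
    (h : Multiset.map a Finset.univ.val = Multiset.map b Finset.univ.val) :
    ∃ σ : Equiv.Perm (Fin n), a = b ∘ σ := by
  have hab : (List.ofFn a).Perm (List.ofFn b) := by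
    rw [← Multiset.coe_eq_coe, List.ofFn_eq_map, List.ofFn_eq_map]
    simpa [Finset.univ, Fintype.elems] using h
  have hsort : a ∘ Tuple.sort a = b ∘ Tuple.sort b := by
    apply List.ofFn_injective
    refine List.Perm.eq_of_sortedLE (Tuple.monotone_sort a).sortedLE_ofFn
      (Tuple.monotone_sort b).sortedLE_ofFn ?_
    exact ((Tuple.sort a).ofFn_comp_perm a).trans
      (hab.trans ((Tuple.sort b).ofFn_comp_perm b).symm)
  refine ⟨(Tuple.sort a).symm.trans (Tuple.sort b), ?_⟩
  ext i
  simpa using congrFun hsort ((Tuple.sort a).symm i)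

theorem roots_charpoly_conj_diagonal {n : ℕ} {U : Mat n} (hU : Uᵀ * U = 1) (d : Fin n → ℝ) :
    (U * diagonal d * Uᵀ).charpoly.roots = Multiset.map d Finset.univ.val := by
  rw [Matrix.charpoly_mul_comm, ← Matrix.mul_assoc, hU, Matrix.one_mul, Matrix.charpoly_diagonal]
  have := Polynomial.roots_multiset_prod_X_sub_C (Multiset.map d Finset.univ.val)
  rwa [Multiset.map_map] at this

theorem exists_perm_of_conj_diagonal_eq {n : ℕ} {U V : Mat n} {a b : Fin n → ℝ}
    (hU : Uᵀ * U = 1) (hV : Vᵀ * V = 1)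
    (h : U * diagonal a * Uᵀ = V * diagonal b * Vᵀ) :
    ∃ σ : Equiv.Perm (Fin n), a = b ∘ σ := by
  apply exists_perm_of_map_univ_eq
  rw [← roots_charpoly_conj_diagonal hU, h, roots_charpoly_conj_diagonal hV]

theorem antitone_eigs {n : ℕ} (A : Mat n) : Antitone (eigs A) := by
  unfold eigs
  split_ifs with h
  · exact fun i j hij => Tuple.monotone_sort h.eigenvalues (Fin.rev_le_rev.mpr hij)
  · exact antitone_const

theorem isHermitian_conj_diagonal {n : ℕ} (U : Mat n) (d : Fin n → ℝ) :
    (U * diagonal d * Uᵀ).IsHermitian := by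
  simp [Matrix.IsHermitian, Matrix.conjTranspose_eq_transpose_of_trivial, Matrix.mul_assoc]

theorem exists_eq_conj_diagonal_eigs {n : ℕ} {A : Mat n} (hA : A.IsHermitian) :
    ∃ U : Mat n, Uᵀ * U = 1 ∧ A = U * diagonal (eigs A) * Uᵀ := by
  set V : Mat n := hA.eigenvectorUnitary.1
  set σ : Equiv.Perm (Fin n) := Fin.revPerm.trans (Tuple.sort hA.eigenvalues)
  have hV : Vᵀ * V = 1 := by
    have := Unitary.coe_star_mul_self hA.eigenvectorUnitary
    rwa [Matrix.star_eq_conjTranspose, Matrix.conjTranspose_eq_transpose_of_trivial] at this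
  have hspec : A = V * diagonal hA.eigenvalues * Vᵀ := by
    have := hA.spectral_theorem
    rw [Unitary.conjStarAlgAut_apply, Matrix.star_eq_conjTranspose,
      Matrix.conjTranspose_eq_transpose_of_trivial] at this
    exact this
  have heigs : eigs A = hA.eigenvalues ∘ σ := by
    unfold eigs
    rw [dif_pos hA]
    rfl
  refine ⟨V.submatrix id σ, ?_, ?_⟩
  · rw [Matrix.transpose_submatrix, Matrix.submatrix_mul _ _ _ id _ Function.bijective_id |>.symm,
      hV, Matrix.submatrix_one_equiv]
  · rw [heigs, ← Matrix.submatrix_diagonal_equiv, Matrix.submatrix_mul_equiv,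
      Matrix.transpose_submatrix, Matrix.submatrix_mul_equiv, ← hspec, Matrix.submatrix_id_id]

theorem eigs_conj_diagonal {n : ℕ} {U : Mat n} {d : Fin n → ℝ} (hU : Uᵀ * U = 1)
    (hd : Antitone d) : eigs (U * diagonal d * Uᵀ) = d := by
  obtain ⟨V, hV, h⟩ := exists_eq_conj_diagonal_eigs (isHermitian_conj_diagonal U d)
  obtain ⟨σ, hσ⟩ := exists_perm_of_conj_diagonal_eq hV hU h.symm
  have := Tuple.unique_antitone (f := d) (σ := σ) (τ := 1) (hσ ▸ antitone_eigs _) hd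
  exact hσ.trans this

/-! ### The trace inequality -/

theorem sum_mul_le_of_mem_doublyStochastic {n : ℕ} {S : Mat n}
    (hS : S ∈ doublyStochastic ℝ (Fin n)) {y a : Fin n → ℝ} (h : Monovary y a) :
    y ⬝ᵥ S *ᵥ a ≤ y ⬝ᵥ a := by
  obtain ⟨w, hw, hsum, rfl⟩ := exists_eq_sum_perm_of_mem_doublyStochastic hS
  rw [Matrix.sum_mulVec, dotProduct_sum]
  calc ∑ σ, y ⬝ᵥ (w σ • Equiv.Perm.permMatrix ℝ σ) *ᵥ a
      ≤ ∑ σ, w σ * (y ⬝ᵥ a) := by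
        refine Finset.sum_le_sum fun σ _ => ?_
        rw [Matrix.smul_mulVec, dotProduct_smul, smul_eq_mul, Matrix.permMatrix_mulVec]
        exact mul_le_mul_of_nonneg_left h.sum_mul_comp_perm_le_sum_mul (hw σ)
    _ = y ⬝ᵥ a := by rw [← Finset.sum_mul, hsum, one_mul]

theorem sq_mem_doublyStochastic {n : ℕ} {Q : Mat n} (hQ : Qᵀ * Q = 1) :
    (of fun i j => Q i j ^ 2 : Mat n) ∈ doublyStochastic ℝ (Fin n) := by
  have hQ' : Q * Qᵀ = 1 := mul_eq_one_comm.mp hQ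
  rw [mem_doublyStochastic_iff_sum]
  refine ⟨fun i j => sq_nonneg _, fun i => ?_, fun j => ?_⟩
  · simpa [Matrix.mul_apply, sq] using congrFun (congrFun hQ' i) i
  · simpa [Matrix.mul_apply, sq] using congrFun (congrFun hQ j) j

theorem frob_conj_diagonal {n : ℕ} (P A : Mat n) (y : Fin n → ℝ) :
    frob (P * diagonal y * Pᵀ) A = ∑ i, y i * (Pᵀ * A * P) i i := by
  have : frob (P * diagonal y * Pᵀ) A = (diagonal y * (Pᵀ * A * P)).trace := by
    unfold frob
    rw [Matrix.transpose_mul, Matrix.transpose_mul, Matrix.transpose_transpose,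
      Matrix.diagonal_transpose, Matrix.mul_assoc, Matrix.trace_mul_comm]
    simp only [Matrix.mul_assoc]
  simp [this, Matrix.trace, Matrix.diagonal_mul]

theorem frob_conj_diagonal_same {n : ℕ} {P : Mat n} (hP : Pᵀ * P = 1) (y d : Fin n → ℝ) :
    frob (P * diagonal y * Pᵀ) (P * diagonal d * Pᵀ) = y ⬝ᵥ d := by
  have : Pᵀ * (P * diagonal d * Pᵀ) * P = diagonal d := by
    simp only [Matrix.mul_assoc, hP]
    simp [← Matrix.mul_assoc, hP]
  simp [frob_conj_diagonal, this, dotProduct]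

theorem frob_conj_diagonal_le {n : ℕ} {P U : Mat n} (hP : Pᵀ * P = 1) (hU : Uᵀ * U = 1)
    {y a : Fin n → ℝ} (hy : Antitone y) (ha : Antitone a) :
    frob (P * diagonal y * Pᵀ) (U * diagonal a * Uᵀ) ≤ y ⬝ᵥ a := by
  have hQ : (Pᵀ * U)ᵀ * (Pᵀ * U) = 1 := by
    rw [Matrix.transpose_mul, Matrix.transpose_transpose, Matrix.mul_assoc, ← Matrix.mul_assoc P,
      mul_eq_one_comm.mp hP, Matrix.one_mul, hU]
  refine le_trans (le_of_eq ?_)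
    (sum_mul_le_of_mem_doublyStochastic (sq_mem_doublyStochastic hQ) (hy.monovary ha))
  have hconj : Pᵀ * (U * diagonal a * Uᵀ) * P = (Pᵀ * U) * diagonal a * (Pᵀ * U)ᵀ := by
    simp only [Matrix.transpose_mul, Matrix.transpose_transpose, Matrix.mul_assoc]
  rw [frob_conj_diagonal, hconj, dotProduct]
  refine Finset.sum_congr rfl fun i _ => congrArg _ ?_
  rw [Matrix.mul_apply]
  refine Finset.sum_congr rfl fun j _ => ?_
  simp only [Matrix.mul_diagonal, Matrix.transpose_apply, Matrix.of_apply]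
  ring

theorem frob_le_dotProduct_eigs {n : ℕ} {P A : Mat n} (hP : Pᵀ * P = 1) (hA : A.IsHermitian)
    {y : Fin n → ℝ} (hy : Antitone y) :
    frob (P * diagonal y * Pᵀ) A ≤ y ⬝ᵥ eigs A := by
  obtain ⟨U, hU, h⟩ := exists_eq_conj_diagonal_eigs hA
  conv_lhs => rw [h]
  exact frob_conj_diagonal_le hP hU hy (antitone_eigs A)

/-! ### Directional derivative of the ordered eigenvalues -/

theorem dirDeriv_eq_of_block_diagonalization {n : ℕ} {x w : Fin n → ℝ} {M Q : Mat n}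
    (hQ : Qᵀ * Q = 1) (hblock : ∀ j k, x j ≠ x k → Q j k = 0)
    (hMQ : ∀ j i, x j = x i → (M * Q) j i = Q j i * w i)
    (hw : ∀ i j, i ≤ j → x i = x j → w j ≤ w i) : dirDeriv x M = w := by
  ext i
  unfold dirDeriv
  extract_lets α e
  have hx : ∀ p, x (e p) = x i := fun p => (Finset.mem_filter.mp (e p).2).2
  have hsum : ∀ f : Fin n → ℝ, (∀ j, x j ≠ x i → f j = 0) → ∑ p, f (e p) = ∑ j, f j := by
    intro f hf
    rw [show ∑ p, f (e p) = ∑ a : α, f a from e.toEquiv.sum_comp fun a : α => f a,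
      Finset.sum_coe_sort α f]
    refine Finset.sum_subset (Finset.subset_univ _) fun j _ hj => hf j fun h => hj ?_
    exact Finset.mem_filter.mpr ⟨Finset.mem_univ j, h⟩
  set R : Mat α.card := of fun p q => Q (e p) (e q) with hR
  set N : Mat α.card := of fun p q => M (e p) (e q) with hN
  have hRR : Rᵀ * R = 1 := by
    ext p q
    have h := hsum (fun j => Q j (e p) * Q j (e q)) fun j hj => by
      simp [hblock j (e p) (by rwa [hx])]
    have h' := congrFun (congrFun hQ (e p)) (e q)
    simp only [Matrix.mul_apply, Matrix.transpose_apply] at h'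
    simp only [Matrix.mul_apply, Matrix.transpose_apply, hR, Matrix.of_apply]
    rw [h, h', Matrix.one_apply, Matrix.one_apply]
    simp [Subtype.ext_iff.symm]
  have hNR : N * R = R * diagonal fun p => w (e p) := by
    ext p q
    have h := hsum (fun j => M (e p) j * Q j (e q)) fun j hj => by
      simp [hblock j (e q) (by rwa [hx])]
    rw [Matrix.mul_diagonal]
    simp only [Matrix.mul_apply, hN, hR, Matrix.of_apply]
    rw [h, ← Matrix.mul_apply, hMQ _ _ (by rw [hx, hx])]
  have hNeq : N = R * (diagonal fun p => w (e p)) * Rᵀ := by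
    rw [← hNR, Matrix.mul_assoc, mul_eq_one_comm.mp hRR, Matrix.mul_one]
  have hanti : Antitone fun p => w (e p) := fun p q hpq =>
    hw _ _ (e.monotone hpq) (by rw [hx, hx])
  rw [hNeq, eigs_conj_diagonal hRR hanti]
  simp

theorem isCompact_setOf_transpose_mul_self_eq_one (n : ℕ) :
    IsCompact {U : Mat n | Uᵀ * U = 1} := by
  have hbox : IsCompact
      (Set.univ.pi fun _ : Fin n => Set.univ.pi fun _ : Fin n => Set.Icc (-1 : ℝ) 1) :=
    isCompact_univ_pi fun _ => isCompact_univ_pi fun _ => isCompact_Icc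
  refine hbox.of_isClosed_subset ?_ ?_
  · exact isClosed_eq (by fun_prop) continuous_const
  · intro (U : Mat n) hU i _ j _
    have hmem : U ∈ Matrix.unitaryGroup (Fin n) ℝ := by
      rw [Matrix.mem_unitaryGroup_iff', Matrix.star_eq_conjTranspose,
        Matrix.conjTranspose_eq_transpose_of_trivial]
      exact hU
    exact abs_le.mp (entry_norm_bound_of_unitary hmem i j)

theorem tendsto_eigs_quotient {n : ℕ} {X P : Mat n} (hP : Pᵀ * P = 1)
    (hX : X = P * diagonal (eigs X) * Pᵀ) (H : Mat n) :
    Tendsto (fun q : ℝ × Mat n => q.1⁻¹ • (eigs (X + q.1 • q.2) - eigs X))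
      (((𝓝[>] (0 : ℝ)) ×ˢ 𝓝 H) ⊓ 𝓟 {q | (X + q.1 • q.2).IsHermitian})
      (𝓝 (dirDeriv (eigs X) (Pᵀ * H * P))) := by
  set x := eigs X
  set φ : ℝ × Mat n → Fin n → ℝ := fun q => q.1⁻¹ • (eigs (X + q.1 • q.2) - x) with hφ
  have hPP : P * Pᵀ = 1 := mul_eq_one_comm.mp hP
  rw [tendsto_iff_ultrafilter]
  intro 𝒰 h𝒰
  have hfst : Tendsto Prod.fst (𝒰 : Filter (ℝ × Mat n)) (𝓝[>] 0) :=
    tendsto_fst.mono_left (h𝒰.trans inf_le_left)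
  have hsnd : Tendsto Prod.snd (𝒰 : Filter (ℝ × Mat n)) (𝓝 H) :=
    tendsto_snd.mono_left (h𝒰.trans inf_le_left)
  have hherm : ∀ᶠ q in (𝒰 : Filter (ℝ × Mat n)), (X + q.1 • q.2).IsHermitian :=
    h𝒰 (mem_inf_of_right (mem_principal_self _))
  have hpos : ∀ᶠ q in (𝒰 : Filter (ℝ × Mat n)), 0 < q.1 :=
    hfst.eventually self_mem_nhdsWithin
  have hfst0 : Tendsto Prod.fst (𝒰 : Filter (ℝ × Mat n)) (𝓝 0) :=
    hfst.mono_right nhdsWithin_le_nhds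
  have hdecomp : ∀ A : Mat n, ∃ U : Mat n,
      Uᵀ * U = 1 ∧ (A.IsHermitian → A = U * diagonal (eigs A) * Uᵀ) := fun A => by
    by_cases hA : A.IsHermitian
    · obtain ⟨U, hU, h⟩ := exists_eq_conj_diagonal_eigs hA
      exact ⟨U, hU, fun _ => h⟩
    · exact ⟨1, by simp, fun h => absurd h hA⟩
  choose U hU hUd using hdecomp
  set V : ℝ × Mat n → Mat n := fun q => Pᵀ * U (X + q.1 • q.2) with hVdef
  have hV : ∀ q, (V q)ᵀ * V q = 1 := fun q => by
    simp only [hVdef]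
    rw [Matrix.transpose_mul, Matrix.transpose_transpose, Matrix.mul_assoc, ← Matrix.mul_assoc P,
      hPP, Matrix.one_mul, hU]
  obtain ⟨Q, hQ, hVQ⟩ := (isCompact_setOf_transpose_mul_self_eq_one n).ultrafilter_le_nhds
    (𝒰.map V) (le_principal_iff.mpr (mem_map.mpr (Eventually.of_forall hV)))
  replace hVQ : Tendsto V 𝒰 (𝓝 Q) := hVQ
  replace hQ : Qᵀ * Q = 1 := hQ
  have hM : Tendsto (fun q : ℝ × Mat n => Pᵀ * q.2 * P) 𝒰 (𝓝 (Pᵀ * H * P)) :=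
    (((continuous_const.matrix_mul continuous_id).matrix_mul continuous_const).tendsto H).comp hsnd
  set M := Pᵀ * H * P
  -- In the basis of columns of P, the perturbed matrix is diagonalized by V.
  have hDV : ∀ᶠ q in (𝒰 : Filter (ℝ × Mat n)),
      (diagonal x + q.1 • (Pᵀ * q.2 * P)) * V q = V q * diagonal (eigs (X + q.1 • q.2)) := by
    filter_upwards [hherm] with q hq
    have h1 : diagonal x + q.1 • (Pᵀ * q.2 * P) = Pᵀ * (X + q.1 • q.2) * P := by
      have : Pᵀ * X * P = diagonal x := by
        rw [hX]
        simp only [Matrix.mul_assoc, hP]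
        simp [← Matrix.mul_assoc, hP]
      rw [Matrix.mul_add, Matrix.add_mul, this, Matrix.mul_smul, Matrix.smul_mul]
    have h2 : ∀ A : Mat n, A.IsHermitian → A * U A = U A * diagonal (eigs A) := fun A hA =>
      calc A * U A = U A * diagonal (eigs A) * (U A)ᵀ * U A := congrArg (· * U A) (hUd A hA)
        _ = U A * diagonal (eigs A) := by rw [Matrix.mul_assoc, hU, Matrix.mul_one]
    simp only [hVdef]
    rw [h1, Matrix.mul_assoc, ← Matrix.mul_assoc P, hPP, Matrix.one_mul, Matrix.mul_assoc, h2 _ hq,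
      Matrix.mul_assoc]
  have hconj : Tendsto (fun q => (V q)ᵀ * ((diagonal x + q.1 • (Pᵀ * q.2 * P)) * V q)) 𝒰
      (𝓝 (Qᵀ * (diagonal x * Q))) := by
    have h := ((continuous_id.matrix_transpose.tendsto Q).comp hVQ).mul ((tendsto_const_nhds (x := diagonal x)).add
      (hfst0.smul hM) |>.mul hVQ)
    simpa using h
  have hdiag : Tendsto (fun q => diagonal (eigs (X + q.1 • q.2))) (𝒰 : Filter (ℝ × Mat n))
      (𝓝 (Qᵀ * (diagonal x * Q))) := by
    refine hconj.congr' ?_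
    filter_upwards [hDV] with q hq
    rw [hq, ← Matrix.mul_assoc, hV, Matrix.one_mul]
  set ℓ : Fin n → ℝ := fun i => (Qᵀ * (diagonal x * Q)) i i with hℓ
  have heigs : Tendsto (fun q => eigs (X + q.1 • q.2)) (𝒰 : Filter (ℝ × Mat n)) (𝓝 ℓ) := by
    rw [tendsto_pi_nhds]
    intro i
    have := (tendsto_pi_nhds.mp (tendsto_pi_nhds.mp hdiag i)) i
    simpa using this
  have hQℓ : Qᵀ * (diagonal x * Q) = diagonal ℓ :=
    tendsto_nhds_unique hdiag (continuous_id.matrix_diagonal.continuousAt.tendsto.comp heigs)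
  have hℓanti : Antitone ℓ := fun i j hij =>
    le_of_tendsto_of_tendsto' (tendsto_pi_nhds.mp heigs j) (tendsto_pi_nhds.mp heigs i)
      fun q => antitone_eigs _ hij
  have hQQ : Q * Qᵀ = 1 := mul_eq_one_comm.mp hQ
  have hxQ : diagonal x * Q = Q * diagonal ℓ := by
    rw [← hQℓ, ← Matrix.mul_assoc, hQQ, Matrix.one_mul]
  have hℓx : ℓ = x := by
    rw [← eigs_conj_diagonal hQ hℓanti, ← hxQ, Matrix.mul_assoc, hQQ, Matrix.mul_one]
    have := eigs_conj_diagonal (U := (1 : Mat n)) (by simp) (antitone_eigs X)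
    simpa using this
  have hblock : ∀ j k, x j ≠ x k → Q j k = 0 := by
    intro j k hjk
    have h := congrFun (congrFun hxQ j) k
    rw [hℓx, Matrix.diagonal_mul, Matrix.mul_diagonal] at h
    have : (x j - x k) * Q j k = 0 := by linarith
    exact (mul_eq_zero.mp this).resolve_left (sub_ne_zero.mpr hjk)
  have hentry : ∀ᶠ q in (𝒰 : Filter (ℝ × Mat n)), ∀ j i, x j = x i →
      (Pᵀ * q.2 * P * V q) j i = V q j i * φ q i := by
    filter_upwards [hDV, hpos] with q hq ht j i hji
    have h := congrFun (congrFun hq j) i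
    rw [Matrix.add_mul, Matrix.smul_mul, Matrix.add_apply, Matrix.smul_apply,
      Matrix.diagonal_mul, Matrix.mul_diagonal, hji, smul_eq_mul] at h
    simp only [hφ, Pi.smul_apply, Pi.sub_apply, smul_eq_mul]
    field_simp
    linarith
  set w : Fin n → ℝ := fun i => (Qᵀ * (M * Q)) i i with hwdef
  have hφw : Tendsto φ 𝒰 (𝓝 w) := by
    rw [tendsto_pi_nhds]
    intro i
    have hnum : Tendsto (fun q => (Qᵀ * (Pᵀ * q.2 * P * V q)) i i) 𝒰 (𝓝 (w i)) :=
      tendsto_pi_nhds.mp (tendsto_pi_nhds.mp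
        ((tendsto_const_nhds (x := Qᵀ)).mul (hM.mul hVQ)) i) i
    have hden : Tendsto (fun q => (Qᵀ * V q) i i) 𝒰 (𝓝 1) := by
      have := tendsto_pi_nhds.mp (tendsto_pi_nhds.mp
        ((tendsto_const_nhds (x := Qᵀ)).mul hVQ) i) i
      rwa [hQ, Matrix.one_apply_eq] at this
    have hdiv := hnum.div hden one_ne_zero
    rw [div_one] at hdiv
    refine hdiv.congr' ?_
    filter_upwards [hentry, hden.eventually_ne one_ne_zero] with q hq hne
    rw [Pi.div_apply, div_eq_iff hne, Matrix.mul_apply, Matrix.mul_apply, Finset.mul_sum]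
    refine Finset.sum_congr rfl fun j _ => ?_
    by_cases hji : x j = x i
    · rw [hq j i hji]
      ring
    · simp [hblock j i hji]
  have hMQ : ∀ j i, x j = x i → (M * Q) j i = Q j i * w i := fun j i hji =>
    tendsto_nhds_unique_of_eventuallyEq
      (tendsto_pi_nhds.mp (tendsto_pi_nhds.mp (hM.mul hVQ) j) i)
      ((tendsto_pi_nhds.mp (tendsto_pi_nhds.mp hVQ j) i).mul (tendsto_pi_nhds.mp hφw i))
      (hentry.mono fun q hq => hq j i hji)
  have hw : ∀ i j, i ≤ j → x i = x j → w j ≤ w i := by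
    intro i j hij hxij
    refine le_of_tendsto_of_tendsto (tendsto_pi_nhds.mp hφw j) (tendsto_pi_nhds.mp hφw i) ?_
    filter_upwards [hpos] with q ht
    simp only [hφ, Pi.smul_apply, Pi.sub_apply, smul_eq_mul, hxij]
    have := antitone_eigs (X + q.1 • q.2) hij
    gcongr
  rw [dirDeriv_eq_of_block_diagonalization hQ hblock hMQ hw]
  exact hφw

/-! ### Spectral functions and subderivatives -/

theorem specFn_conj_diagonal {n : ℕ} {θ : (Fin n → ℝ) → EReal}
    (hsym : ∀ (σ : Equiv.Perm (Fin n)) (x : Fin n → ℝ), θ (x ∘ σ) = θ x)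
    {P : Mat n} (hP : Pᵀ * P = 1) (z : Fin n → ℝ) :
    specFn θ (P * diagonal z * Pᵀ) = θ z := by
  have hZ := isHermitian_conj_diagonal P z
  obtain ⟨U, hU, h⟩ := exists_eq_conj_diagonal_eigs hZ
  obtain ⟨σ, hσ⟩ := exists_perm_of_conj_diagonal_eq hU hP h.symm
  rw [specFn, if_pos hZ, hσ, hsym]

theorem le_inv_mul_sub_of_add_le {r t s : ℝ} (ht : 0 < t) {v : EReal}
    (h : (r : EReal) + ((t * s : ℝ) : EReal) ≤ v) :
    (s : EReal) ≤ ((1 / t : ℝ) : EReal) * (v - r) := by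
  induction v with
  | bot => exact absurd (le_bot_iff.mp h) (by rw [← EReal.coe_add]; exact EReal.coe_ne_bot _)
  | top =>
    rw [EReal.top_sub_coe, EReal.coe_mul_top_of_pos (by positivity)]
    exact le_top
  | coe v =>
    norm_cast at h ⊢
    rw [one_div, le_inv_mul_iff₀ ht]
    linarith

theorem dotProduct_le_vSubderiv {n : ℕ} {θ : (Fin n → ℝ) → EReal} {x y : Fin n → ℝ} {r : ℝ}
    (hr : θ x = r) (hy : ∀ z, θ x + ((y ⬝ᵥ (z - x) : ℝ) : EReal) ≤ θ z) (w : Fin n → ℝ) :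
    ((y ⬝ᵥ w : ℝ) : EReal) ≤ vSubderiv θ x w := by
  refine le_of_forall_lt fun c hc => ?_
  obtain ⟨c', hcc', hc'⟩ := exists_between hc
  refine hcc'.trans_le (le_liminf_of_le (by isBoundedDefault) ?_)
  have hcont : Continuous fun v : Fin n → ℝ => ((y ⬝ᵥ v : ℝ) : EReal) :=
    continuous_coe_real_ereal.comp (by unfold dotProduct; fun_prop)
  have hev : ∀ᶠ q : ℝ × (Fin n → ℝ) in (𝓝[>] (0 : ℝ)) ×ˢ 𝓝 w,
      c' < ((y ⬝ᵥ q.2 : ℝ) : EReal) :=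
    tendsto_snd.eventually ((hcont.tendsto w).eventually (lt_mem_nhds hc'))
  filter_upwards [hev, tendsto_fst.eventually self_mem_nhdsWithin] with q hq ht
  refine hq.le.trans ?_
  rw [hr]
  apply le_inv_mul_sub_of_add_le ht
  have := hy (x + q.1 • q.2)
  rwa [add_sub_cancel_left, dotProduct_smul, smul_eq_mul, hr] at this

theorem vSubderiv_le_MSubderiv {n : ℕ} {θ : (Fin n → ℝ) → EReal} {X P : Mat n}
    (hXh : X.IsHermitian) (hP : Pᵀ * P = 1) (hX : X = P * diagonal (eigs X) * Pᵀ) {r : ℝ}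
    (hr : θ (eigs X) = r) (H : Mat n) :
    vSubderiv θ (eigs X) (dirDeriv (eigs X) (Pᵀ * H * P)) ≤ MSubderiv (specFn θ) X H := by
  refine le_of_forall_lt fun c hc => ?_
  obtain ⟨c', hcc', hc'⟩ := exists_between hc
  refine hcc'.trans_le (le_liminf_of_le (by isBoundedDefault) ?_)
  have hev := eventually_lt_of_lt_liminf hc'
  have hfst : Tendsto Prod.fst
      (((𝓝[>] (0 : ℝ)) ×ˢ 𝓝 H) ⊓ 𝓟 {q | (X + q.1 • q.2).IsHermitian}) (𝓝[>] (0 : ℝ)) :=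
    tendsto_fst.mono_left inf_le_left
  have hpull := (hfst.prodMk (tendsto_eigs_quotient hP hX H)).eventually hev
  rw [eventually_inf_principal] at hpull
  filter_upwards [hpull, tendsto_fst.eventually self_mem_nhdsWithin] with q hq (ht : 0 < q.1)
  rw [specFn, specFn, if_pos hXh]
  split_ifs with hh
  · have := hq hh
    rw [smul_inv_smul₀ ht.ne', add_sub_cancel] at this
    exact this.le
  · rw [hr, EReal.top_sub_coe, EReal.coe_mul_top_of_pos (by positivity)]
    exact le_top

theorem frob_le_dotProduct_dirDeriv {n : ℕ} {X P H : Mat n} {y : Fin n → ℝ} (hP : Pᵀ * P = 1)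
    (hXh : X.IsHermitian) (hX : X = P * diagonal (eigs X) * Pᵀ) (hH : H.IsHermitian)
    (hy : Antitone y) :
    frob (P * diagonal y * Pᵀ) H ≤ y ⬝ᵥ dirDeriv (eigs X) (Pᵀ * H * P) := by
  have hherm : ∀ t : ℝ, (X + t • H).IsHermitian := fun t =>
    hXh.add (hH.smul (IsSelfAdjoint.all t))
  have hpath : Tendsto (fun t : ℝ => (t, H)) (𝓝[>] 0)
      (((𝓝[>] (0 : ℝ)) ×ˢ 𝓝 H) ⊓ 𝓟 {q | (X + q.1 • q.2).IsHermitian}) :=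
    tendsto_inf.mpr ⟨tendsto_id.prodMk tendsto_const_nhds,
      tendsto_principal.mpr (Eventually.of_forall hherm)⟩
  have hcont : Continuous fun v : Fin n → ℝ => y ⬝ᵥ v := by
    unfold dotProduct
    fun_prop
  refine ge_of_tendsto
    ((hcont.tendsto _).comp ((tendsto_eigs_quotient hP hX H).comp hpath)) ?_
  filter_upwards [self_mem_nhdsWithin] with t (ht : 0 < t)
  have h1 := frob_le_dotProduct_eigs hP (hherm t) hy
  have h2 : frob (P * diagonal y * Pᵀ) X = y ⬝ᵥ eigs X := by
    conv_lhs => rw [hX]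
    exact frob_conj_diagonal_same hP y (eigs X)
  have h3 : frob (P * diagonal y * Pᵀ) (X + t • H)
      = frob (P * diagonal y * Pᵀ) X + t * frob (P * diagonal y * Pᵀ) H := by
    simp [frob, Matrix.mul_add]
  simp only [Function.comp_apply]
  rw [dotProduct_smul, dotProduct_sub, smul_eq_mul, le_inv_mul_iff₀ ht]
  linarith

theorem statement19 {n : ℕ} (θ : (Fin n → ℝ) → EReal)
    (hsym : ∀ (σ : Equiv.Perm (Fin n)) (x : Fin n → ℝ), θ (x ∘ σ) = θ x)
    (hpoly : PolyPi θ)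
    (hproper : (∀ x, θ x ≠ ⊥) ∧ ∃ x, θ x ≠ ⊤)
    (X Y P : Mat n) (hX : X.IsHermitian) (hY : Y.IsHermitian)
    (hP : Pᵀ * P = 1)
    (hXd : X = P * Matrix.diagonal (eigs X) * Pᵀ)
    (hYd : Y = P * Matrix.diagonal (eigs Y) * Pᵀ)
    (hsub : Y ∈ MSubdiff (specFn θ) X)
    (H : Mat n) (hH : H ∈ MCrit (specFn θ) X Y) :
    dirDeriv (eigs X) (Pᵀ * H * P) ∈ vCrit θ (eigs X) (eigs Y) := by
  obtain ⟨hHh, hHeq⟩ := hH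
  obtain ⟨-, hsub⟩ := hsub
  have hgX : specFn θ X = θ (eigs X) := if_pos hX
  have hsubgrad : ∀ z, θ (eigs X) + ((eigs Y ⬝ᵥ (z - eigs X) : ℝ) : EReal) ≤ θ z := by
    intro z
    have h := hsub (P * diagonal z * Pᵀ) (isHermitian_conj_diagonal P z)
    have hfrob : frob Y (P * diagonal z * Pᵀ - X) = eigs Y ⬝ᵥ (z - eigs X) := by
      have hdiff : P * diagonal z * Pᵀ - X = P * diagonal (z - eigs X) * Pᵀ := by
        conv_lhs => rw [hXd]
        rw [← Matrix.sub_mul, ← Matrix.mul_sub, Matrix.diagonal_sub]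
        rfl
      rw [hdiff]
      conv_lhs => rw [hYd]
      exact frob_conj_diagonal_same hP _ _
    rwa [hgX, hfrob, specFn_conj_diagonal hsym hP] at h
  obtain ⟨r, hr⟩ : ∃ r : ℝ, θ (eigs X) = r := by
    obtain ⟨hbot, z, hz⟩ := hproper
    refine ⟨(θ (eigs X)).toReal, (EReal.coe_toReal (fun htop => hz ?_) (hbot _)).symm⟩
    have := hsubgrad z
    rwa [htop, EReal.top_add_coe, top_le_iff] at this
  refine le_antisymm (dotProduct_le_vSubderiv hr hsubgrad _) ?_
  refine (vSubderiv_le_MSubderiv hX hP hXd hr H).trans ?_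
  rw [← hHeq, EReal.coe_le_coe_iff]
  have := frob_le_dotProduct_dirDeriv hP hX hXd hHh (antitone_eigs Y)
  rwa [← hYd] at this

end
end
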